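/- arXiv:math/0007030 — 3 statements merged into one kernel-verified Lean document; each statement's English description precedes it below -/
import Mathlib

section
/- Let Z be a complex Gaussian random variable with mean zero and variance σ² > 0 (i.e., E|Z|² = σ²). Then for every measurable set E with ν(E) > 0, |∫_E log|Z| dν − ν(E)·log σ| ≤ ν(E)·(log(1/ν(E)) + 1/4). -/
open MeasureTheory Real

open ProbabilityTheory in
/-- The moment of order `p > -1` of the standard exponential distribution is `Γ (p + 1)`. -/
lemma integrable_rpow_expMeasure_one {p : ℝ} (hp : -1 < p) :
    Integrable (fun t : ℝ => t ^ p) (expMeasure 1) ∧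
      ∫ t, t ^ p ∂(expMeasure 1) = Gamma (p + 1) := by
  have hmeas : Measurable (gammaPDF 1 1) := (measurable_gammaPDFReal 1 1).ennreal_ofReal
  have hfin : ∀ᵐ t : ℝ, gammaPDF 1 1 t < ⊤ := ae_of_all _ fun _ => ENNReal.ofReal_lt_top
  have hdens : (fun t : ℝ => (gammaPDF 1 1 t).toReal • t ^ p) =ᵐ[volume]
      (Set.Ioi (0 : ℝ)).indicator fun t => exp (-t) * t ^ (p + 1 - 1) := by
    filter_upwards [Measure.ae_ne volume (0 : ℝ)] with t ht
    rcases lt_or_gt_of_ne ht with h | h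
    · simp [gammaPDF_of_neg h, h.le]
    · simp [gammaPDF_of_nonneg h.le, h, (exp_pos _).le]
  constructor
  · rw [expMeasure, gammaMeasure, integrable_withDensity_iff_integrable_smul' hmeas hfin,
      integrable_congr hdens, integrable_indicator_iff measurableSet_Ioi]
    exact GammaIntegral_convergent (by linarith)
  · rw [expMeasure, gammaMeasure, integral_withDensity_eq_integral_toReal_smul hmeas hfin,
      integral_congr_ae hdens, integral_indicator measurableSet_Ioi,
      Gamma_eq_integral (by linarith)]

open ProbabilityTheory in
/-- Half the square of a Rayleigh variable is a standard exponential variable. -/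
lemma map_sq_div_two_eq_expMeasure {Ω : Type*} [MeasurableSpace Ω] {ν : Measure Ω}
    [IsProbabilityMeasure ν] {R : Ω → ℝ} (hR : Measurable R) (hR0 : ∀ x, 0 ≤ R x)
    (hlaw : ∀ s : ℝ, 0 ≤ s → ν {x | R x ≤ s} = ENNReal.ofReal (1 - exp (-s ^ 2 / 2))) :
    ν.map (fun x => R x ^ 2 / 2) = expMeasure 1 := by
  have hT : Measurable fun x => R x ^ 2 / 2 := by fun_prop
  have := Measure.isProbabilityMeasure_map (μ := ν) hT.aemeasurable
  have := isProbabilityMeasure_expMeasure one_pos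
  refine Measure.eq_of_cdf _ _ (StieltjesFunction.ext fun t => ?_)
  rw [cdf_expMeasure_eq one_pos, cdf_eq_real, measureReal_def,
    Measure.map_apply hT measurableSet_Iic]
  split_ifs with ht
  · have hset : (fun x => R x ^ 2 / 2) ⁻¹' Set.Iic t = {x | R x ≤ √(2 * t)} := by
      ext x
      simp only [Set.mem_preimage, Set.mem_Iic, Set.mem_ofPred_eq]
      rw [le_sqrt (hR0 x) (by positivity), div_le_iff₀ two_pos, mul_comm]
    rw [hset, hlaw _ (sqrt_nonneg _), neg_div, sq_sqrt (by positivity),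
      ENNReal.toReal_ofReal (by simpa using ht)]
    congr 3
    ring
  · have hset : (fun x => R x ^ 2 / 2) ⁻¹' Set.Iic t = ∅ := by
      ext x
      simp only [Set.mem_preimage, Set.mem_Iic, Set.mem_empty_iff_false, iff_false]
      have := sq_nonneg (R x)
      linarith
    simp [hset]

/-- Both a Rayleigh variable and its inverse have expectation `√(π / 2)`. -/
lemma integrable_and_integral_of_rayleigh {Ω : Type*} [MeasurableSpace Ω] {ν : Measure Ω}
    [IsProbabilityMeasure ν] {R : Ω → ℝ} (hR : Measurable R) (hR0 : ∀ x, 0 ≤ R x)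
    (hlaw : ∀ s : ℝ, 0 ≤ s → ν {x | R x ≤ s} = ENNReal.ofReal (1 - exp (-s ^ 2 / 2))) :
    (Integrable R ν ∧ ∫ x, R x ∂ν = √(π / 2)) ∧
      (Integrable (fun x => (R x)⁻¹) ν ∧ ∫ x, (R x)⁻¹ ∂ν = √(π / 2)) := by
  have hT : AEMeasurable (fun x => R x ^ 2 / 2) ν := by fun_prop
  have hmap := map_sq_div_two_eq_expMeasure hR hR0 hlaw
  have hmoment : ∀ p : ℝ, -1 < p → Integrable (fun x => (R x ^ 2 / 2) ^ p) ν ∧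
      ∫ x, (R x ^ 2 / 2) ^ p ∂ν = Gamma (p + 1) := by
    intro p hp
    have hpow : Measurable fun t : ℝ => t ^ p := measurable_id.pow_const p
    obtain ⟨hi, hv⟩ := integrable_rpow_expMeasure_one hp
    rw [← hmap] at hi hv
    exact ⟨hi.comp_aemeasurable hT,
      by rw [← hv, integral_map hT hpow.aestronglyMeasurable]⟩
  have hsqrt : ∀ x, √2 * (R x ^ 2 / 2) ^ (1 / 2 : ℝ) = R x := fun x => by
    rw [← sqrt_eq_rpow, sqrt_div (sq_nonneg _), sqrt_sq (hR0 x)]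
    field_simp
  have hinv : ∀ x, (√2)⁻¹ * (R x ^ 2 / 2) ^ (-(1 / 2) : ℝ) = (R x)⁻¹ := fun x => by
    rw [rpow_neg (by positivity), ← mul_inv, hsqrt]
  obtain ⟨hi, hv⟩ := hmoment (1 / 2) (by norm_num)
  obtain ⟨hi', hv'⟩ := hmoment (-(1 / 2)) (by norm_num)
  have h2 : √2 * √2 = 2 := mul_self_sqrt zero_le_two
  refine ⟨⟨(hi.const_mul (√2)).congr (ae_of_all _ hsqrt), ?_⟩,
    ⟨(hi'.const_mul (√2)⁻¹).congr (ae_of_all _ hinv), ?_⟩⟩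
  · rw [← integral_congr_ae (ae_of_all _ hsqrt), integral_const_mul, hv,
      Gamma_add_one (by norm_num), Gamma_one_half_eq, sqrt_div pi_pos.le]
    field_simp
    nlinarith
  · rw [← integral_congr_ae (ae_of_all _ hinv), integral_const_mul, hv',
      show (-(1 / 2) + 1 : ℝ) = 1 / 2 by norm_num, Gamma_one_half_eq, sqrt_div pi_pos.le]
    field_simp

/-- Jensen's inequality for the logarithm on a subset of a measure space: if `∫ X ≤ exp c`,
then `∫_E log X ≤ ν(E) (log (1 / ν(E)) + c)`. -/
lemma setIntegral_log_le {Ω : Type*} [MeasurableSpace Ω] {ν : Measure Ω} [IsFiniteMeasure ν]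
    {X : Ω → ℝ} (hX : ∀ᵐ x ∂ν, 0 < X x) (hint : Integrable X ν) {c : ℝ}
    (hc : ∫ x, X x ∂ν ≤ exp c) {E : Set Ω} (hEpos : 0 < ν E)
    (hlog : IntegrableOn (fun x => log (X x)) E ν) :
    ∫ x in E, log (X x) ∂ν ≤ (ν E).toReal * (log (1 / (ν E).toReal) + c) := by
  set m := (ν E).toReal with hm
  have hm0 : 0 < m := ENNReal.toReal_pos hEpos.ne' (measure_ne_top ν E)
  have hpoint : ∀ᵐ x ∂ν.restrict E, log (X x) ≤ m * exp (-c) * X x + (log (1 / m) + c - 1) := by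
    filter_upwards [ae_restrict_of_ae hX] with x hx
    have h := log_le_sub_one_of_pos (show 0 < m * exp (-c) * X x by positivity)
    rw [log_mul (by positivity) hx.ne', log_mul hm0.ne' (exp_pos _).ne', log_exp] at h
    rw [one_div, log_inv]
    linarith
  have hlin : IntegrableOn (fun x => m * exp (-c) * X x) E ν :=
    (hint.const_mul _).integrableOn
  have hE : ∫ x in E, X x ∂ν ≤ exp c :=
    (setIntegral_le_integral hint (hX.mono fun _ h => h.le)).trans hc
  calc ∫ x in E, log (X x) ∂ν
      ≤ ∫ x in E, (m * exp (-c) * X x + (log (1 / m) + c - 1)) ∂ν :=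
        integral_mono_ae hlog (hlin.add (integrable_const _)) hpoint
    _ = m * exp (-c) * ∫ x in E, X x ∂ν + m * (log (1 / m) + c - 1) := by
        rw [integral_add hlin (integrable_const _), integral_const_mul, setIntegral_const,
          smul_eq_mul, measureReal_def]
    _ ≤ m * exp (-c) * exp c + m * (log (1 / m) + c - 1) := by gcongr
    _ = m * (log (1 / m) + c) := by
        rw [mul_assoc, ← exp_add, neg_add_cancel, exp_zero]
        ring

lemma sqrt_pi_div_two_le_exp_quarter : √(π / 2) ≤ exp (1 / 4) := by
  rw [sqrt_le_left (exp_pos _).le, ← exp_nat_mul]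
  have h := quadratic_le_exp_of_nonneg (show (0 : ℝ) ≤ (2 : ℕ) * (1 / 4) by norm_num)
  have := pi_lt_d2
  norm_num at h ⊢
  linarith

lemma abs_log_le_add_inv {r : ℝ} (hr : 0 < r) : |log r| ≤ r + r⁻¹ := by
  have h := log_le_sub_one_of_pos hr
  have h' := log_le_sub_one_of_pos (inv_pos.2 hr)
  have := inv_pos.2 hr
  rw [log_inv] at h'
  exact abs_le.2 ⟨by linarith, by linarith⟩

/-- Offord's key lemma: if `Z` is a complex Gaussian random variable with mean zero and
variance `σ² > 0` (so that `Z/σ` is standard, `Pr(|Z| ≤ σ s) = 1 - exp(-s²/2)`), then for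
every measurable set `E` with `ν(E) > 0`,
`|∫_E log|Z| dν − ν(E) log σ| ≤ ν(E) (log(1/ν(E)) + 1/4)`. -/
theorem stmt_2 {Ω : Type*} [MeasurableSpace Ω] (ν : Measure Ω) [IsProbabilityMeasure ν]
    (Z : Ω → ℂ) (hZmeas : Measurable Z) (σ : ℝ) (hσ : 0 < σ)
    (hmean : ∫ x, Z x ∂ν = 0)
    (hlaw : ∀ s : ℝ, 0 ≤ s →
      ν {x | ‖Z x‖ ≤ σ * s} = ENNReal.ofReal (1 - Real.exp (-s ^ 2 / 2)))
    (E : Set Ω) (hE : MeasurableSet E) (hEpos : 0 < ν E) :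
    |(∫ x in E, Real.log ‖Z x‖ ∂ν) - (ν E).toReal * Real.log σ|
      ≤ (ν E).toReal * (Real.log (1 / (ν E).toReal) + 1 / 4) := by
  have hR : Measurable fun x => ‖Z x‖ / σ := by fun_prop
  have hlaw' : ∀ s : ℝ, 0 ≤ s →
      ν {x | ‖Z x‖ / σ ≤ s} = ENNReal.ofReal (1 - Real.exp (-s ^ 2 / 2)) := fun s hs => by
    simp only [← hlaw s hs, div_le_iff₀' hσ]
  obtain ⟨⟨hi, hv⟩, hi', hv'⟩ :=
    integrable_and_integral_of_rayleigh hR (fun x => by positivity) hlaw'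
  have hpos : ∀ᵐ x ∂ν, 0 < ‖Z x‖ / σ := by
    have h0 : ν {x | ‖Z x‖ / σ ≤ 0} = 0 := by simp [hlaw' 0 le_rfl]
    simpa [ae_iff] using h0
  have hlog : IntegrableOn (fun x => log (‖Z x‖ / σ)) E ν :=
    ((hi.add hi').mono' hR.log.aestronglyMeasurable
      (hpos.mono fun x hx => abs_log_le_add_inv hx)).integrableOn
  have hlog' : IntegrableOn (fun x => log (‖Z x‖ / σ)⁻¹) E ν := by
    simp only [log_inv]
    exact hlog.neg
  have hupper := setIntegral_log_le hpos hi (hv.trans_le sqrt_pi_div_two_le_exp_quarter) hEpos hlog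
  have hlower := setIntegral_log_le (hpos.mono fun x hx => inv_pos.2 hx) hi'
    (hv'.trans_le sqrt_pi_div_two_le_exp_quarter) hEpos hlog'
  simp only [log_inv, integral_neg] at hlower
  have hsplit : ∫ x in E, log ‖Z x‖ ∂ν =
      (∫ x in E, log (‖Z x‖ / σ) ∂ν) + (ν E).toReal * log σ := by
    have hconst : ∫ _ in E, log σ ∂ν = (ν E).toReal * log σ := by
      rw [setIntegral_const, smul_eq_mul, measureReal_def]
    rw [← hconst, ← integral_add hlog (integrable_const _)]
    refine integral_congr_ae (ae_restrict_of_ae (hpos.mono fun x hx => ?_))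
    have hZ : ‖Z x‖ ≠ 0 := fun h => by simp [h] at hx
    simp only [log_div hZ hσ.ne', sub_add_cancel]
  rw [hsplit, add_sub_cancel_right]
  exact abs_le.2 ⟨by linarith, hupper⟩
end

section
/- Let G ⊆ ℂ be a domain and K₁, K₂ : G × G → ℂ hermitian-positive kernels, analytic in the first variable and anti-analytic in the second, with K₁(z,z) > 0 on G. Suppose K₂(z,z) = e^{2u(z)} K₁(z,z) for a harmonic function u on a simply connected domain G. Then there exists a zero-free analytic function g on G with |g| = e^u and K₂(z,w) = g(z)·conj(g(w))·K₁(z,w) for all z, w ∈ G. -/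
open MeasureTheory Real Complex

/-- A continuous function is harmonic on an open set iff it satisfies the mean value
property on all circles contained (with their disks) in the set. -/
def HarmonicOn (u : ℂ → ℝ) (G : Set ℂ) : Prop :=
  ContinuousOn u G ∧
    ∀ z ∈ G, ∀ r : ℝ, 0 < r → Metric.closedBall z r ⊆ G →
      u z = (1 / (2 * Real.pi)) *
        ∫ θ in (0 : ℝ)..(2 * Real.pi), u (z + r * Complex.exp (θ * Complex.I))

/-- A kernel `K` on `G × G` is hermitian-positive if all finite quadratic forms
`Σ_{i,j} c_i conj(c_j) K(w_i, w_j)` with nodes in `G` are nonnegative reals. -/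
def HermitianPositive (K : ℂ → ℂ → ℂ) (G : Set ℂ) : Prop :=
  ∀ (n : ℕ) (w : Fin n → ℂ) (c : Fin n → ℂ), (∀ i, w i ∈ G) →
    (∑ i, ∑ j, c i * (starRingEnd ℂ) (c j) * K (w i) (w j)).im = 0 ∧
      0 ≤ (∑ i, ∑ j, c i * (starRingEnd ℂ) (c j) * K (w i) (w j)).re

namespace SesquianalyticKernel

open Metric Set Filter Topology ComplexConjugate

/-- A bounded holomorphic function on a disc satisfies a Schwarz-type Lipschitz estimate at the
centre. -/
lemma dist_le_of_norm_le {f : ℂ → ℂ} {a z : ℂ} {ρ M : ℝ}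
    (hf : DifferentiableOn ℂ f (ball a ρ)) (hM : ∀ x ∈ ball a ρ, ‖f x‖ ≤ M)
    (hz : z ∈ ball a ρ) : dist (f z) (f a) ≤ 2 * M / ρ * dist z a := by
  have hρ : 0 < ρ := pos_of_mem_ball hz
  refine Complex.dist_le_div_mul_dist_of_mapsTo_ball hf (fun x hx => ?_) hz
  rw [mem_closedBall, dist_eq_norm]
  linarith [norm_sub_le (f x) (f a), hM x hx, hM a (mem_ball_self hρ)]

/-- The divided difference at the centre of a disc of a bounded holomorphic function is bounded. -/
lemma norm_dslope_le_of_norm_le {f : ℂ → ℂ} {a z : ℂ} {ρ M : ℝ}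
    (hf : DifferentiableOn ℂ f (ball a ρ)) (hM : ∀ x ∈ ball a ρ, ‖f x‖ ≤ M)
    (hz : z ∈ ball a ρ) : ‖dslope f a z‖ ≤ 2 * M / ρ := by
  have hρ : 0 < ρ := pos_of_mem_ball hz
  refine Complex.norm_dslope_le_div_of_mapsTo_ball hf (fun x hx => ?_) hz
  rw [mem_closedBall, dist_eq_norm]
  linarith [norm_sub_le (f x) (f a), hM x hx, hM a (mem_ball_self hρ)]

/-- The divided difference in the first variable of a bounded separately holomorphic function is
jointly continuous. -/
lemma continuousAt_dslope_uncurry {Φ : ℂ → ℂ → ℂ} {a b : ℂ} {ρ M : ℝ} (hρ : 0 < ρ)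
    (h₁ : ∀ w ∈ ball b ρ, DifferentiableOn ℂ (fun z => Φ z w) (ball a ρ))
    (h₂ : ∀ z ∈ ball a ρ, DifferentiableOn ℂ (Φ z) (ball b ρ))
    (hM : ∀ z ∈ ball a ρ, ∀ w ∈ ball b ρ, ‖Φ z w‖ ≤ M) :
    ContinuousAt (fun p : ℂ × ℂ => dslope (fun z => Φ z p.2) a p.1) (a, b) := by
  set B := 2 * (2 * M / ρ) / ρ with hB
  have hM0 : 0 ≤ M := (norm_nonneg _).trans (hM a (mem_ball_self hρ) b (mem_ball_self hρ))
  have hB0 : 0 ≤ B := by positivity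
  have key : ∀ z ∈ ball a ρ, ∀ w ∈ ball b ρ,
      dist (dslope (fun z => Φ z w) a z) (dslope (fun z => Φ z w) a a) ≤ B * dist z a := by
    intro z hz w hw
    refine dist_le_of_norm_le ?_ (fun x hx => ?_) hz
    · exact (Complex.differentiableOn_dslope (ball_mem_nhds a hρ)).2 (h₁ w hw)
    · exact norm_dslope_le_of_norm_le (h₁ w hw) (fun y hy => hM y hy w hw) hx
  rw [Metric.continuousAt_iff']
  intro ε hε
  obtain ⟨t, ht0, htρ, htB⟩ : ∃ t : ℝ, 0 < t ∧ t < ρ ∧ B * t < ε / 4 := by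
    refine ⟨min (ρ / 2) (ε / (8 * (B + 1))), by positivity,
      (min_le_left _ _).trans_lt (by linarith), ?_⟩
    calc B * min (ρ / 2) (ε / (8 * (B + 1))) ≤ (B + 1) * (ε / (8 * (B + 1))) := by
          gcongr
          · linarith
          · exact min_le_right _ _
      _ = ε / 8 := by field_simp
      _ < ε / 4 := by linarith
  set z₁ : ℂ := a + (t : ℂ) with hz₁
  have hd1 : dist z₁ a = t := by simp [hz₁, abs_of_pos ht0]
  have hz₁m : z₁ ∈ ball a ρ := by rw [mem_ball, hd1]; exact htρ
  have hne : z₁ ≠ a := by rw [← dist_pos, hd1]; exact ht0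
  have hcont : ContinuousAt (fun w => dslope (fun z => Φ z w) a z₁) b := by
    simp only [dslope_of_ne _ hne, slope_def_field]
    have c1 := ((h₂ z₁ hz₁m).differentiableAt (ball_mem_nhds b hρ)).continuousAt
    have c2 := ((h₂ a (mem_ball_self hρ)).differentiableAt (ball_mem_nhds b hρ)).continuousAt
    exact (c1.sub c2).div_const _
  have e1 := Metric.continuousAt_iff'.1 hcont (ε / 4) (by positivity)
  have hbρ := ball_mem_nhds b hρ
  rw [nhds_prod_eq]
  filter_upwards [prod_mem_prod (ball_mem_nhds a ht0) (inter_mem e1 hbρ)]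
  rintro ⟨z, w⟩ ⟨hz, hw, hwρ⟩
  simp only [mem_ofPred_eq] at hz hw hwρ ⊢
  have k1 := key z (ball_subset_ball htρ.le hz) w hwρ
  have k2 := key z₁ hz₁m w hwρ
  have k3 := key z₁ hz₁m b (mem_ball_self hρ)
  rw [hd1] at k2 k3
  have k4 : B * dist z a ≤ B * t := by gcongr; exact (mem_ball.1 hz).le
  have t1 := dist_triangle4 (dslope (fun z => Φ z w) a z) (dslope (fun z => Φ z w) a a)
    (dslope (fun z => Φ z w) a z₁) (dslope (fun z => Φ z b) a a)
  have t2 := dist_triangle (dslope (fun z => Φ z w) a z₁) (dslope (fun z => Φ z b) a z₁)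
    (dslope (fun z => Φ z b) a a)
  rw [dist_comm] at k2
  linarith

/-- A bounded separately holomorphic function is holomorphic along holomorphic curves. -/
lemma differentiableAt_comp_curve {Φ : ℂ → ℂ → ℂ} {U V : Set ℂ} (hU : IsOpen U) (hV : IsOpen V)
    {M : ℝ} (h₁ : ∀ w ∈ V, DifferentiableOn ℂ (fun z => Φ z w) U)
    (h₂ : ∀ z ∈ U, DifferentiableOn ℂ (Φ z) V)
    (hM : ∀ z ∈ U, ∀ w ∈ V, ‖Φ z w‖ ≤ M) {p q : ℂ → ℂ} {x₀ : ℂ}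
    (hp : DifferentiableAt ℂ p x₀) (hq : DifferentiableAt ℂ q x₀)
    (hpU : p x₀ ∈ U) (hqV : q x₀ ∈ V) :
    DifferentiableAt ℂ (fun x => Φ (p x) (q x)) x₀ := by
  obtain ⟨r, hr, hrU⟩ := Metric.isOpen_iff.1 hU _ hpU
  obtain ⟨s, hs, hsV⟩ := Metric.isOpen_iff.1 hV _ hqV
  have hrU' : ball (p x₀) (min r s) ⊆ U := (ball_subset_ball (min_le_left _ _)).trans hrU
  have hsV' : ball (q x₀) (min r s) ⊆ V := (ball_subset_ball (min_le_right _ _)).trans hsV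
  have hcont := continuousAt_dslope_uncurry (Φ := Φ) (a := p x₀) (b := q x₀) (lt_min hr hs)
    (fun w hw => (h₁ w (hsV' hw)).mono hrU') (fun z hz => (h₂ z (hrU' hz)).mono hsV')
    (fun z hz w hw => hM z (hrU' hz) w (hsV' hw))
  set Q : ℂ → ℂ := fun x => dslope (fun z => Φ z (q x)) (p x₀) (p x) with hQ
  have hQc : ContinuousAt Q x₀ :=
    ContinuousAt.comp (f := fun x => (p x, q x)) (x := x₀) hcont
      (hp.continuousAt.prodMk hq.continuousAt)
  have hdecomp : (fun x => Φ (p x) (q x)) =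
      fun x => Φ (p x₀) (q x) + (p x - p x₀) * Q x := by
    funext x
    have := sub_smul_dslope (fun z => Φ z (q x)) (p x₀) (p x)
    simp only [smul_eq_mul] at this
    rw [hQ, this]; ring
  rw [hdecomp]
  refine DifferentiableAt.add ?_ ?_
  · exact ((h₂ _ hpU).differentiableAt (hV.mem_nhds hqV)).comp x₀ hq
  · have hp' := hp.hasDerivAt
    refine HasDerivAt.differentiableAt (f' := deriv p x₀ * Q x₀) ?_
    rw [hasDerivAt_iff_tendsto_slope] at hp' ⊢
    have hQt : Tendsto Q (𝓝[≠] x₀) (𝓝 (Q x₀)) := hQc.tendsto.mono_left nhdsWithin_le_nhds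
    refine (hp'.mul hQt).congr fun x => ?_
    simp only [slope_def_field]
    ring

/-- A holomorphic function on a disc centred at `0` that vanishes at real points vanishes. -/
lemma eqOn_zero_of_real {f : ℂ → ℂ} {r : ℝ} (hf : DifferentiableOn ℂ f (ball 0 r))
    (h0 : ∀ x : ℝ, |x| < r → f x = 0) : ∀ z ∈ ball (0 : ℂ) r, f z = 0 := by
  intro z hz
  have hr : 0 < r := pos_of_mem_ball hz
  refine (hf.analyticOnNhd isOpen_ball).eqOn_zero_of_preconnected_of_frequently_eq_zero
    (convex_ball (0 : ℂ) r).isPreconnected (mem_ball_self hr) ?_ hz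
  have ht : Tendsto (fun x : ℝ => (x : ℂ)) (𝓝[≠] 0) (𝓝[≠] 0) := by
    refine tendsto_nhdsWithin_iff.2 ⟨?_, ?_⟩
    · exact (Complex.continuous_ofReal.tendsto' 0 0 (by simp)).mono_left nhdsWithin_le_nhds
    · filter_upwards [self_mem_nhdsWithin] with x hx
      simpa using hx
  refine ht.frequently (Eventually.frequently ?_)
  filter_upwards [nhdsWithin_le_nhds (ball_mem_nhds (0 : ℝ) hr)] with x hx
  exact h0 x (by simpa using hx)

/-- A bounded function, holomorphic in the first variable and antiholomorphic in the second, that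
vanishes on the diagonal of a disc vanishes on the bidisc of half the radius. -/
lemma eq_zero_of_diag_of_bounded {L : ℂ → ℂ → ℂ} {c : ℂ} {R M : ℝ}
    (h₁ : ∀ w ∈ ball c R, DifferentiableOn ℂ (fun z => L z w) (ball c R))
    (h₂ : ∀ z ∈ ball c R, DifferentiableOn ℂ (fun w => conj (L z w)) (ball c R))
    (hM : ∀ z ∈ ball c R, ∀ w ∈ ball c R, ‖L z w‖ ≤ M)
    (hdiag : ∀ z ∈ ball c R, L z z = 0) :
    ∀ z ∈ ball c (R / 2), ∀ w ∈ ball c (R / 2), L z w = 0 := by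
  set Φ : ℂ → ℂ → ℂ := fun a b => L (c + a) (c + conj b) with hΦ
  have mem1 : ∀ {a : ℂ}, a ∈ ball (0 : ℂ) R → c + a ∈ ball c R := fun ha => by simpa using ha
  have mem2 : ∀ {a : ℂ}, a ∈ ball (0 : ℂ) R → c + conj a ∈ ball c R := fun ha => by simpa using ha
  have g₁ : ∀ w ∈ ball (0 : ℂ) R, DifferentiableOn ℂ (fun z => Φ z w) (ball 0 R) :=
    fun w hw => (h₁ _ (mem2 hw)).comp (by fun_prop) fun z hz => mem1 hz
  have g₂ : ∀ z ∈ ball (0 : ℂ) R, DifferentiableOn ℂ (Φ z) (ball 0 R) := by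
    intro z hz w hw
    have hd : DifferentiableOn ℂ (fun b => conj (L (c + z) (c + b))) (ball 0 R) :=
      (h₂ _ (mem1 hz)).comp (by fun_prop) fun b hb => mem1 hb
    have hw' : conj w ∈ ball (0 : ℂ) R := by simpa using hw
    have := (hd.differentiableAt (isOpen_ball.mem_nhds hw')).conj_conj
    have h3 : Φ z = conj ∘ (fun b => conj (L (c + z) (c + b))) ∘ conj := by
      funext b; simp [hΦ]
    rw [h3]
    simpa using this.differentiableWithinAt
  have gM : ∀ z ∈ ball (0 : ℂ) R, ∀ w ∈ ball (0 : ℂ) R, ‖Φ z w‖ ≤ M :=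
    fun z hz w hw => hM _ (mem1 hz) _ (mem2 hw)
  have madd : ∀ {x y : ℂ}, ‖x‖ < R / 2 → ‖y‖ < R / 2 → x + I * y ∈ ball (0 : ℂ) R := by
    intro x y hx hy
    rw [mem_ball_zero_iff]
    refine (norm_add_le _ _).trans_lt ?_
    simp only [norm_mul, norm_I, one_mul]; linarith
  have msub : ∀ {x y : ℂ}, ‖x‖ < R / 2 → ‖y‖ < R / 2 → x - I * y ∈ ball (0 : ℂ) R := by
    intro x y hx hy
    have := madd hx (y := -y) (by simpa using hy)
    simpa [sub_eq_add_neg] using this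
  have vreal : ∀ x y : ℝ, |x| < R / 2 → |y| < R / 2 →
      Φ (x + I * y) (x - I * y) = 0 := by
    intro x y hx hy
    have hm : (x : ℂ) + I * y ∈ ball (0 : ℂ) R := madd (by simpa using hx) (by simpa using hy)
    have := hdiag _ (mem1 hm)
    simpa [hΦ] using this
  have vx : ∀ y : ℝ, |y| < R / 2 → ∀ x ∈ ball (0 : ℂ) (R / 2),
      Φ (x + I * y) (x - I * y) = 0 := by
    intro y hy
    refine eqOn_zero_of_real (fun x hx => ?_) fun x hx => vreal x y hx hy
    have hx' : ‖x‖ < R / 2 := by simpa using hx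
    have hy' : ‖(y : ℂ)‖ < R / 2 := by simpa using hy
    exact (differentiableAt_comp_curve isOpen_ball isOpen_ball g₁ g₂ gM
      (p := fun x => x + I * y) (q := fun x => x - I * y) (by fun_prop) (by fun_prop)
      (madd hx' hy') (msub hx' hy')).differentiableWithinAt
  have vxy : ∀ x ∈ ball (0 : ℂ) (R / 2), ∀ y ∈ ball (0 : ℂ) (R / 2),
      Φ (x + I * y) (x - I * y) = 0 := by
    intro x hx
    refine eqOn_zero_of_real (fun y hy => ?_) fun y hy => vx y hy x hx
    have hx' : ‖x‖ < R / 2 := by simpa using hx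
    have hy' : ‖y‖ < R / 2 := by simpa using hy
    exact (differentiableAt_comp_curve isOpen_ball isOpen_ball g₁ g₂ gM
      (p := fun y => x + I * y) (q := fun y => x - I * y) (by fun_prop) (by fun_prop)
      (madd hx' hy') (msub hx' hy')).differentiableWithinAt
  intro z hz w hw
  have ha : ‖z - c‖ < R / 2 := by simpa [dist_eq_norm] using hz
  have hb : ‖conj (w - c)‖ < R / 2 := by
    rw [RCLike.norm_conj]; simpa [dist_eq_norm] using hw
  have := vxy ((z - c + conj (w - c)) / 2)
    (by
      rw [mem_ball_zero_iff, norm_div]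
      have := norm_add_le (z - c) (conj (w - c))
      simp only [RCLike.norm_ofNat]; linarith)
    (-I * (z - c - conj (w - c)) / 2)
    (by
      rw [mem_ball_zero_iff, norm_div]
      have := norm_sub_le (z - c) (conj (w - c))
      simp only [neg_mul, norm_neg, norm_mul, norm_I, one_mul, RCLike.norm_ofNat]; linarith)
  have e1 : (z - c + conj (w - c)) / 2 + I * (-I * (z - c - conj (w - c)) / 2) = z - c := by
    linear_combination (-(z - c - conj (w - c)) / 2) * I_mul_I
  have e2 : (z - c + conj (w - c)) / 2 - I * (-I * (z - c - conj (w - c)) / 2)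
      = conj (w - c) := by
    linear_combination ((z - c - conj (w - c)) / 2) * I_mul_I
  rw [e1, e2] at this
  simpa [hΦ] using this

/-- **Osgood's lemma**: a separately continuous function on a bidisc is bounded on a smaller
bidisc centred on the diagonal. -/
lemma exists_ball_bounded {L : ℂ → ℂ → ℂ} {c : ℂ} {R : ℝ} (hR : 0 < R)
    (h₁ : ∀ w ∈ ball c R, ContinuousOn (fun z => L z w) (ball c R))
    (h₂ : ∀ z ∈ ball c R, ContinuousOn (L z) (ball c R)) :
    ∃ a : ℂ, ∃ r > 0, ∃ M : ℝ, ball a r ⊆ ball c R ∧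
      ∀ z ∈ ball a r, ∀ w ∈ ball a r, ‖L z w‖ ≤ M := by
  have hR2 : closedBall c (R / 2) ⊆ ball c R := closedBall_subset_ball (by linarith)
  have hb2 : ball c (R / 2) ⊆ ball c R := ball_subset_closedBall.trans hR2
  have hBaire : BaireSpace (ball c (R / 2)) := isOpen_ball.baireSpace
  have hne : Nonempty (ball c (R / 2)) := ⟨⟨c, mem_ball_self (by linarith)⟩⟩
  let E : ℕ → Set (ball c (R / 2)) := fun n => ⋂ z ∈ closedBall c (R / 2), {w | ‖L z w‖ ≤ n}
  have hclosed : ∀ n, IsClosed (E n) := fun n => by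
    refine isClosed_biInter fun z hz => isClosed_le ?_ continuous_const
    exact (continuousOn_iff_continuous_domRestrict.1 ((h₂ z (hR2 hz)).mono hb2)).norm
  have hunion : ⋃ n, E n = univ := by
    refine eq_univ_of_forall fun w => ?_
    obtain ⟨C, hC⟩ := (isCompact_closedBall c (R / 2)).exists_bound_of_continuousOn
      ((h₁ w (hb2 w.2)).mono hR2)
    obtain ⟨n, hn⟩ := exists_nat_ge C
    exact mem_iUnion.2 ⟨n, mem_iInter₂.2 fun z hz => (hC z hz).trans hn⟩
  obtain ⟨n, ⟨a, ha⟩⟩ := nonempty_interior_of_iUnion_of_closed hclosed hunion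
  have hopen : IsOpen ((↑) '' interior (E n) : Set ℂ) :=
    isOpen_ball.isOpenMap_subtype_val _ isOpen_interior
  obtain ⟨r, hr, hsub⟩ := Metric.isOpen_iff.1 hopen a ⟨a, ha, rfl⟩
  have hsub2 : ball (a : ℂ) r ⊆ ball c (R / 2) := by
    intro x hx
    obtain ⟨y, -, rfl⟩ := hsub hx
    exact y.2
  refine ⟨a, r, hr, n, hsub2.trans hb2, fun z hz w hw => ?_⟩
  obtain ⟨y, hy, rfl⟩ := hsub hw
  exact mem_iInter₂.1 (interior_subset hy) z (ball_subset_closedBall (hsub2 hz))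

/-- The identity theorem for functions holomorphic on a connected open set, on a disc. -/
lemma eqOn_of_eqOn_ball {f g : ℂ → ℂ} {U : Set ℂ} (hU : IsOpen U) (hUc : IsPreconnected U)
    (hf : DifferentiableOn ℂ f U) (hg : DifferentiableOn ℂ g U) {a : ℂ} {r : ℝ} (hr : 0 < r)
    (haU : a ∈ U) (h : EqOn f g (ball a r)) : EqOn f g U :=
  (hf.analyticOnNhd hU).eqOn_of_preconnected_of_eventuallyEq (hg.analyticOnNhd hU) hUc haU
    (h.eventuallyEq_of_mem (ball_mem_nhds a hr))

/-- A function on a bidisc, separately holomorphic in the first variable and antiholomorphic in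
the second, is determined by its values on the diagonal. -/
lemma eq_zero_of_diag {L : ℂ → ℂ → ℂ} {c : ℂ} {R : ℝ}
    (h₁ : ∀ w ∈ ball c R, DifferentiableOn ℂ (fun z => L z w) (ball c R))
    (h₂ : ∀ z ∈ ball c R, DifferentiableOn ℂ (fun w => conj (L z w)) (ball c R))
    (hdiag : ∀ z ∈ ball c R, L z z = 0) :
    ∀ z ∈ ball c R, ∀ w ∈ ball c R, L z w = 0 := by
  intro z hz w hw
  have hR : 0 < R := pos_of_mem_ball hz
  obtain ⟨a, r, hr, M, hsub, hM⟩ := exists_ball_bounded hR (fun w hw => (h₁ w hw).continuousOn)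
    (fun z hz => by simpa using! (h₂ z hz).continuousOn.star)
  have hz0 := eq_zero_of_diag_of_bounded (fun w hw => (h₁ w (hsub hw)).mono hsub)
    (fun z hz => (h₂ z (hsub hz)).mono hsub) hM (fun z hz => hdiag z (hsub hz))
  have hpre := (convex_ball c R).isPreconnected
  have hr2 : 0 < r / 2 := by linarith
  have haU : a ∈ ball c R := hsub (mem_ball_self hr)
  have hsub' : ball a (r / 2) ⊆ ball c R := (ball_subset_ball (by linarith)).trans hsub
  have step : ∀ w ∈ ball a (r / 2), L z w = 0 := fun w hw =>
    eqOn_of_eqOn_ball (g := fun _ => 0) isOpen_ball hpre (h₁ w (hsub' hw))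
      (differentiableOn_const _) hr2 haU (fun x hx => hz0 x hx w hw) hz
  have := eqOn_of_eqOn_ball (g := fun _ => 0) isOpen_ball hpre (h₂ z hz)
    (differentiableOn_const _) hr2 haU (fun x hx => by simp [step x hx]) hw
  simpa using this

theorem circleAverage_eq_of_harmonicOn {u : ℂ → ℝ} {G : Set ℂ} (hu : HarmonicOn u G) {z : ℂ}
    {r : ℝ} (hr : 0 < r) (h : closedBall z r ⊆ G) : circleAverage u z r = u z := by
  rw [hu.2 z (h (mem_closedBall_self hr.le)) r hr h, circleAverage_def]
  simp [circleMap]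

theorem circleIntegrable_of_harmonicOn {u : ℂ → ℝ} {G : Set ℂ} (hu : HarmonicOn u G) {z : ℂ}
    {r : ℝ} (hr : 0 < r) (h : closedBall z r ⊆ G) : CircleIntegrable u z r :=
  (hu.1.mono (sphere_subset_closedBall.trans h)).circleIntegrable hr.le

theorem harmonicOn_of_circleAverage_eq {u : ℂ → ℝ} {G : Set ℂ} (hu : ContinuousOn u G)
    (h : ∀ z r, 0 < r → closedBall z r ⊆ G → circleAverage u z r = u z) : HarmonicOn u G := by
  refine ⟨hu, fun z _ r hr hs => ?_⟩
  rw [← h z r hr hs, circleAverage_def]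
  simp [circleMap]

theorem circleAverage_re {P : ℂ → ℂ} (hP : Differentiable ℂ P) (z : ℂ) {r : ℝ} (hr : 0 < r) :
    circleAverage (fun x => (P x).re) z r = (P z).re := by
  have h := (reCLM).circleAverage_comp_comm (f := P) (c := z) (R := r)
    (hP.continuous.continuousOn.circleIntegrable hr.le)
  have h' : circleAverage P z r = P z := (hP.diffContOnCl).circleAverage
  rw [h'] at h
  exact h

theorem harmonicOn_sub_re {u : ℂ → ℝ} {G : Set ℂ} (hu : HarmonicOn u G) {P : ℂ → ℂ}
    (hP : Differentiable ℂ P) : HarmonicOn (fun x => u x - (P x).re) G := by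
  have hc : Continuous fun x => (P x).re := continuous_re.comp hP.continuous
  refine harmonicOn_of_circleAverage_eq (hu.1.sub hc.continuousOn) fun z r hr h => ?_
  rw [circleAverage_fun_sub (circleIntegrable_of_harmonicOn hu hr h)
    (hc.continuousOn.circleIntegrable hr.le), circleAverage_eq_of_harmonicOn hu hr h,
    circleAverage_re hP z hr]

theorem harmonicOn_neg {u : ℂ → ℝ} {G : Set ℂ} (hu : HarmonicOn u G) :
    HarmonicOn (fun x => -u x) G := by
  refine ⟨hu.1.neg, fun z hz r hr h => ?_⟩
  have := hu.2 z hz r hr h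
  simp only [intervalIntegral.integral_neg]
  rw [this]
  ring

theorem circleAverage_norm_sq (z : ℂ) {r : ℝ} (hr : 0 < r) :
    circleAverage (fun x => ‖x‖ ^ 2) z r = ‖z‖ ^ 2 + r ^ 2 := by
  have h : EqOn (fun x : ℂ => ‖x‖ ^ 2)
      (fun x => ((r ^ 2 - ‖z‖ ^ 2 : ℝ) + 2 * conj z * x : ℂ).re) (sphere z |r|) := by
    intro x hx
    have hx' : ‖x - z‖ ^ 2 = r ^ 2 := by
      rw [mem_sphere_iff_norm.1 hx, sq_abs]
    simp only [← normSq_eq_norm_sq, normSq_apply, sub_re, sub_im] at hx' ⊢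
    rw [add_re, ofReal_re, mul_assoc, mul_re, mul_re, mul_im]
    simp only [conj_re, conj_im, re_ofNat, im_ofNat]
    nlinarith
  rw [circleAverage_congr_sphere h,
    circleAverage_re (P := fun x => ((r ^ 2 - ‖z‖ ^ 2 : ℝ) + 2 * conj z * x : ℂ)) (by fun_prop) z hr]
  rw [add_re, ofReal_re, mul_assoc, mul_re, mul_re, mul_im]
  simp only [← normSq_eq_norm_sq, normSq_apply, conj_re, conj_im, re_ofNat, im_ofNat]
  ring

/-- Maximum principle for functions with the mean value property. -/
theorem le_of_le_on_sphere {v : ℂ → ℝ} {M : ℝ} (hv : HarmonicOn v (closedBall 0 1))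
    (hM : ∀ z ∈ sphere (0 : ℂ) 1, v z ≤ M) : ∀ z ∈ closedBall (0 : ℂ) 1, v z ≤ M := by
  intro z hz
  refine le_of_forall_pos_le_add fun ε hε => ?_
  have hfc : ContinuousOn (fun x : ℂ => v x + ε * ‖x‖ ^ 2) (closedBall 0 1) :=
    hv.1.add (by fun_prop)
  obtain ⟨a, ha, hmax⟩ := (isCompact_closedBall (0 : ℂ) 1).exists_isMaxOn ⟨z, hz⟩ hfc
  have hza : v z + ε * ‖z‖ ^ 2 ≤ v a + ε * ‖a‖ ^ 2 := hmax hz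
  rcases (mem_closedBall_zero_iff.1 ha).lt_or_eq with ha1 | ha1
  · exfalso
    have hr : 0 < 1 - ‖a‖ := by linarith
    have hs : closedBall a (1 - ‖a‖) ⊆ closedBall 0 1 :=
      closedBall_subset_closedBall' (by simp)
    have hle := circleAverage_mono_on_of_le_circle
      ((hfc.mono (sphere_subset_closedBall.trans hs)).circleIntegrable hr.le)
      (a := v a + ε * ‖a‖ ^ 2) (fun x hx => hmax (hs (by
        rw [abs_of_pos hr] at hx; exact sphere_subset_closedBall hx)))
    have h2 : circleAverage (fun x : ℂ => ε * ‖x‖ ^ 2) a (1 - ‖a‖) =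
        ε * (‖a‖ ^ 2 + (1 - ‖a‖) ^ 2) := by
      rw [← circleAverage_norm_sq a hr]
      exact circleAverage_fun_smul (a := ε) (f := fun x : ℂ => ‖x‖ ^ 2)
    rw [circleAverage_fun_add (circleIntegrable_of_harmonicOn hv hr hs)
      (Continuous.continuousOn (by fun_prop) |>.circleIntegrable hr.le),
      circleAverage_eq_of_harmonicOn hv hr hs, h2] at hle
    nlinarith [mul_pos hε (pow_pos hr 2)]
  · have := hM a (mem_sphere_zero_iff_norm.2 ha1)
    rw [ha1] at hza
    nlinarith [mul_nonneg hε.le (sq_nonneg ‖z‖)]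

/-- Continuous functions on the unit circle are uniform limits of real parts of entire functions. -/
theorem exists_entire_re_approx {v : ℂ → ℝ} (hv : ContinuousOn v (sphere 0 1)) {ε : ℝ}
    (hε : 0 < ε) : ∃ P : ℂ → ℂ, Differentiable ℂ P ∧
      ∀ z ∈ sphere (0 : ℂ) 1, |v z - (P z).re| ≤ ε := by
  have : Fact (0 < 2 * π) := ⟨Real.two_pi_pos⟩
  have hcirc : ∀ t : Circle, (t : ℂ) ∈ sphere (0 : ℂ) 1 := fun t => by
    rw [mem_sphere_zero_iff_norm, Circle.norm_coe]
  let f : C(AddCircle (2 * π), ℂ) :=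
    ⟨fun t => (v (AddCircle.toCircle t) : ℂ), by
      refine continuous_ofReal.comp (hv.comp_continuous ?_ fun t => hcirc _)
      exact continuous_subtype_val.comp AddCircle.continuous_toCircle⟩
  have hf : f ∈ (Submodule.span ℂ (range <| @fourier (2 * π))).topologicalClosure := by
    rw [span_fourier_closure_eq_top]; trivial
  obtain ⟨q, hq, hfq⟩ := Metric.mem_closure_iff.1 hf ε hε
  have key : ∃ P Q : ℂ → ℂ, Differentiable ℂ P ∧ Differentiable ℂ Q ∧
      ∀ t : AddCircle (2 * π), q t = P (AddCircle.toCircle t) + conj (Q (AddCircle.toCircle t)) := by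
    clear hfq
    induction hq using Submodule.span_induction with
    | mem x hx =>
      obtain ⟨n, rfl⟩ := hx
      obtain ⟨k, rfl | rfl⟩ := n.eq_nat_or_neg
      · exact ⟨fun z => z ^ k, fun _ => 0, by fun_prop, by fun_prop, fun t => by
          simp [fourier_apply, AddCircle.toCircle_nsmul]⟩
      · exact ⟨fun _ => 0, fun z => z ^ k, by fun_prop, by fun_prop, fun t => by
          rw [fourier_neg]
          simp [fourier_apply, AddCircle.toCircle_nsmul]⟩
    | zero => exact ⟨fun _ => 0, fun _ => 0, by fun_prop, by fun_prop, by simp⟩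
    | add x y _ _ hx hy =>
      obtain ⟨P, Q, hP, hQ, h⟩ := hx
      obtain ⟨P', Q', hP', hQ', h'⟩ := hy
      refine ⟨fun z => P z + P' z, fun z => Q z + Q' z, hP.add hP', hQ.add hQ', fun t => ?_⟩
      simp [h, h']
      ring
    | smul a x _ hx =>
      obtain ⟨P, Q, hP, hQ, h⟩ := hx
      refine ⟨fun z => a * P z, fun z => conj a * Q z, hP.const_mul _, hQ.const_mul _, fun t => ?_⟩
      simp [h]
      ring
  obtain ⟨P, Q, hP, hQ, hPQ⟩ := key
  refine ⟨fun z => P z + Q z, hP.add hQ, fun z hz => ?_⟩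
  obtain ⟨t, ht⟩ : ∃ t : AddCircle (2 * π), (AddCircle.toCircle t : ℂ) = z := by
    obtain ⟨t, ht⟩ := (AddCircle.homeomorphCircle (T := 2 * π) Real.two_pi_pos.ne').surjective
      ⟨z, by simpa [Submonoid.unitSphere] using hz⟩
    refine ⟨t, ?_⟩
    rw [AddCircle.homeomorphCircle_apply] at ht
    rw [ht]
  have h1 : ‖f t - q t‖ < ε := by
    rw [← dist_eq_norm]
    exact (ContinuousMap.dist_apply_le_dist t).trans_lt hfq
  have h2 : (f t - q t).re = v z - (P z + Q z).re := by
    rw [hPQ, ht]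
    simp [f, ht]
  rw [← h2]
  exact (abs_re_le_norm _).trans h1.le

/-- Poisson formula for functions with the mean value property. -/
theorem circleAverage_poisson_of_harmonicOn {v : ℂ → ℝ} (hv : HarmonicOn v (closedBall 0 1))
    {w : ℂ} (hw : w ∈ ball (0 : ℂ) 1) :
    circleAverage ((Complex.re ∘ herglotzRieszKernel 0 w) • v) 0 1 = v w := by
  have hvs := hv.1.mono (sphere_subset_closedBall (x := (0 : ℂ)) (ε := 1))
  have hk : ContinuousOn (Complex.re ∘ herglotzRieszKernel 0 w) (sphere 0 1) :=
    continuous_re.comp_continuousOn (by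
      simpa using continuousOn_herglotzRieszKernel_sphere hw)
  have hk0 : ∀ x ∈ sphere (0 : ℂ) 1, 0 ≤ (Complex.re ∘ herglotzRieszKernel 0 w) x := by
    intro x hx
    refine le_trans ?_ (le_re_herglotzRieszKernel hx hw)
    have := mem_ball_zero_iff.1 hw
    rw [sub_zero]
    exact div_nonneg (by linarith) (by positivity)
  have hpoisson : ∀ P : ℂ → ℂ, Differentiable ℂ P →
      circleAverage ((Complex.re ∘ herglotzRieszKernel 0 w) • fun x => (P x).re) 0 1 = (P w).re := by
    intro P hP
    have h := (reCLM).circleAverage_comp_comm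
      (f := (Complex.re ∘ herglotzRieszKernel 0 w) • P) (c := 0) (R := 1)
      ((hk.smul hP.continuous.continuousOn).circleIntegrable zero_le_one)
    rw [hP.diffContOnCl.circleAverage_re_herglotzRieszKernel_smul hw] at h
    rw [← reCLM_apply, ← h]
    congr 1
    ext x
    simp
  refine eq_of_forall_dist_le fun ε hε => ?_
  obtain ⟨P, hP, hPv⟩ := exists_entire_re_approx hvs (half_pos hε)
  have hd := harmonicOn_sub_re hv hP
  have h1 : v w - (P w).re ≤ ε / 2 :=
    le_of_le_on_sphere hd (fun z hz => (abs_le.1 (hPv z hz)).2) w (ball_subset_closedBall hw)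
  have h2 : -(v w - (P w).re) ≤ ε / 2 :=
    le_of_le_on_sphere (harmonicOn_neg hd) (fun z hz => by
      linarith [(abs_le.1 (hPv z hz)).1]) w (ball_subset_closedBall hw)
  have hint : ∀ {f : ℂ → ℝ}, ContinuousOn f (sphere 0 1) →
      CircleIntegrable ((Complex.re ∘ herglotzRieszKernel 0 w) • f) 0 1 := fun hf =>
    (hk.smul hf).circleIntegrable zero_le_one
  have h3 : circleAverage ((Complex.re ∘ herglotzRieszKernel 0 w) • v) 0 1 ≤
      ((P w) + (ε / 2 : ℝ)).re := by
    rw [← hpoisson (fun x => P x + (ε / 2 : ℝ)) (by fun_prop)]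
    refine circleAverage_mono (hint hvs)
      (hint (continuous_re.comp (hP.continuous.add continuous_const)).continuousOn) fun x hx => ?_
    rw [abs_one] at hx
    refine mul_le_mul_of_nonneg_left ?_ (hk0 x hx)
    simp only [add_re, ofReal_re]
    linarith [(abs_le.1 (hPv x hx)).2]
  have h4 : ((P w) - (ε / 2 : ℝ)).re ≤
      circleAverage ((Complex.re ∘ herglotzRieszKernel 0 w) • v) 0 1 := by
    rw [← hpoisson (fun x => P x - (ε / 2 : ℝ)) (by fun_prop)]
    refine circleAverage_mono
      (hint (continuous_re.comp (hP.continuous.sub continuous_const)).continuousOn) (hint hvs) fun x hx => ?_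
    rw [abs_one] at hx
    refine mul_le_mul_of_nonneg_left ?_ (hk0 x hx)
    simp only [sub_re, ofReal_re]
    linarith [(abs_le.1 (hPv x hx)).1]
  rw [add_re, ofReal_re] at h3
  rw [sub_re, ofReal_re] at h4
  rw [Real.dist_eq, abs_le]
  constructor <;> linarith

theorem harmonicOn_comp_affine {u : ℂ → ℝ} {c : ℂ} {R : ℝ} (hR : 0 < R)
    (hu : HarmonicOn u (closedBall c R)) :
    HarmonicOn (fun z => u (c + R * z)) (closedBall 0 1) := by
  have hmaps : MapsTo (fun z : ℂ => c + R * z) (closedBall 0 1) (closedBall c R) := by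
    intro z hz
    rw [mem_closedBall_zero_iff] at hz
    rw [mem_closedBall_iff_norm]
    simpa [abs_of_pos hR] using mul_le_mul_of_nonneg_left hz hR.le
  have hR0 : (R : ℂ) ≠ 0 := by exact_mod_cast hR.ne'
  refine ⟨hu.1.comp (by fun_prop) hmaps, fun z hz r hr hs => ?_⟩
  have hs' : closedBall (c + R * z) (R * r) ⊆ closedBall c R := by
    intro x hx
    have hx' : (x - c) / R ∈ closedBall z r := by
      rw [mem_closedBall_iff_norm] at hx ⊢
      have : (x - c) / R - z = (x - (c + R * z)) / R := by
        field_simp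
        ring
      rw [this, norm_div, norm_real, Real.norm_of_nonneg hR.le, div_le_iff₀ hR]
      linarith
    have := hmaps (hs hx')
    have hx2 : c + R * ((x - c) / R) = x := by
      field_simp
      ring
    simpa only [hx2] using this
  refine (hu.2 _ (hmaps hz) (R * r) (mul_pos hR hr) hs').trans ?_
  congr 2
  ext θ
  congr 1
  push_cast
  ring

/-- Locally, `exp u` is the modulus of an analytic function. -/
theorem exists_local_modulus {u : ℂ → ℝ} {G : Set ℂ} (hG : IsOpen G) (hu : HarmonicOn u G) {c : ℂ}
    (hc : c ∈ G) : ∃ r > 0, ball c r ⊆ G ∧ ∃ g : ℂ → ℂ, DifferentiableOn ℂ g (ball c r) ∧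
      ∀ z ∈ ball c r, ‖g z‖ = Real.exp (u z) := by
  obtain ⟨R, hR, hRG⟩ := nhds_basis_closedBall.mem_iff.1 (hG.mem_nhds hc)
  have hv : HarmonicOn (fun z => u (c + R * z)) (closedBall 0 1) :=
    harmonicOn_comp_affine hR ⟨hu.1.mono hRG, fun z hz r hr h => hu.2 z (hRG hz) r hr (h.trans hRG)⟩
  have hvi : CircleIntegrable (fun z => u (c + R * z)) 0 1 :=
    circleIntegrable_of_harmonicOn hv one_pos subset_rfl
  have hvi' : CircleIntegrable (fun z => (u (c + R * z) : ℂ)) 0 1 :=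
    (continuous_ofReal.comp_continuousOn
      (hv.1.mono sphere_subset_closedBall)).circleIntegrable zero_le_one
  have hF := differentiableOn_circleAverage_herglotzRieszKernel_smul hvi'
  set F : ℂ → ℂ := fun w => circleAverage
    (fun ζ ↦ herglotzRieszKernel 0 w ζ • (u (c + R * ζ) : ℂ)) 0 1 with hFdef
  have hmaps : MapsTo (fun z : ℂ => (z - c) / R) (ball c R) (ball 0 1) := by
    intro z hz
    rw [mem_ball_iff_norm] at hz
    rw [mem_ball_zero_iff, norm_div, norm_real, Real.norm_of_nonneg hR.le, div_lt_one hR]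
    exact hz
  refine ⟨R, hR, ball_subset_closedBall.trans hRG, fun z => Complex.exp (F ((z - c) / R)), ?_, ?_⟩
  · exact (hF.comp (by fun_prop) hmaps).cexp
  · intro z hz
    rw [Complex.norm_exp, re_circleAverage_herglotzRieszKernel_smul hvi (hmaps hz),
      circleAverage_poisson_of_harmonicOn hv (hmaps hz)]
    congr 2
    have : (R : ℂ) ≠ 0 := by exact_mod_cast hR.ne'
    field_simp
    ring

/-- `g` is analytic near `z`, has modulus `exp u`, and links `K₂` to `K₁` over `D`. -/
def IsLocalFactor (G : Set ℂ) (u : ℂ → ℝ) (K₁ K₂ : ℂ → ℂ → ℂ) (D : Set ℂ) (γ : ℂ → ℂ) (z : ℂ)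
    (r : ℝ) (g : ℂ → ℂ) : Prop :=
  0 < r ∧ ball z r ⊆ G ∧ DifferentiableOn ℂ g (ball z r) ∧
    (∀ x ∈ ball z r, ‖g x‖ = Real.exp (u x)) ∧
    ∀ x ∈ ball z r, ∀ w ∈ D, K₂ x w = g x * conj (γ w) * K₁ x w

theorem IsLocalFactor.restrict {G : Set ℂ} {u : ℂ → ℝ} {K₁ K₂ : ℂ → ℂ → ℂ} {D : Set ℂ}
    {γ : ℂ → ℂ} {z : ℂ} {r : ℝ} {g : ℂ → ℂ} (h : IsLocalFactor G u K₁ K₂ D γ z r g) {x : ℂ}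
    (hx : x ∈ ball z r) : ∃ s, IsLocalFactor G u K₁ K₂ D γ x s g := by
  obtain ⟨s, hs, hsub⟩ := Metric.isOpen_iff.1 isOpen_ball x hx
  exact ⟨s, hs, hsub.trans h.2.1, h.2.2.1.mono hsub, fun y hy => h.2.2.2.1 y (hsub hy),
    fun y hy => h.2.2.2.2 y (hsub hy)⟩

theorem exists_const_of_norm_eq {f g : ℂ → ℂ} {a : ℂ} {r : ℝ} (hr : 0 < r)
    (hf : DifferentiableOn ℂ f (ball a r)) (hg : DifferentiableOn ℂ g (ball a r))
    (hg0 : ∀ x ∈ ball a r, g x ≠ 0) (h : ∀ x ∈ ball a r, ‖f x‖ = ‖g x‖) :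
    ∃ l : ℂ, ‖l‖ = 1 ∧ ∀ x ∈ ball a r, f x = l * g x := by
  have hn : ∀ x ∈ ball a r, ‖f x / g x‖ = 1 := fun x hx => by
    rw [norm_div, h x hx, div_self (norm_ne_zero_iff.2 (hg0 x hx))]
  have ha := mem_ball_self (x := a) hr
  have hc := Complex.eqOn_of_isPreconnected_of_isMaxOn_norm (f := fun x => f x / g x) (c := a)
    (convex_ball a r).isPreconnected isOpen_ball (hf.div hg hg0) ha
    fun x hx => by
      simp only [mem_ofPred_eq, Function.comp_apply]
      rw [hn x hx, hn a ha]
  exact ⟨f a / g a, hn a ha, fun x hx => (div_eq_iff (hg0 x hx)).1 (hc hx)⟩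

/-- Two kernels whose diagonals differ by the factor `exp (2 u)` differ by a factor
`g z * conj (g w)`. -/
theorem exists_factor {G : Set ℂ} (hG : IsOpen G) (hGc : IsPreconnected G) {K₁ K₂ : ℂ → ℂ → ℂ}
    (h₁ : ∀ w ∈ G, DifferentiableOn ℂ (fun z => K₁ z w) G)
    (h₁' : ∀ z ∈ G, DifferentiableOn ℂ (fun w => conj (K₁ z w)) G)
    (h₂ : ∀ w ∈ G, DifferentiableOn ℂ (fun z => K₂ z w) G)
    (h₂' : ∀ z ∈ G, DifferentiableOn ℂ (fun w => conj (K₂ z w)) G)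
    (hne : ∀ z ∈ G, K₁ z z ≠ 0) {u : ℂ → ℝ} (hu : HarmonicOn u G)
    (hdiag : ∀ z ∈ G, K₂ z z = (Real.exp (2 * u z) : ℂ) * K₁ z z) :
    ∃ g : ℂ → ℂ, DifferentiableOn ℂ g G ∧ (∀ z ∈ G, ‖g z‖ = Real.exp (u z)) ∧
      ∀ z ∈ G, ∀ w ∈ G, K₂ z w = g z * conj (g w) * K₁ z w := by
  rcases G.eq_empty_or_nonempty with rfl | ⟨c, hc⟩
  · exact ⟨0, by simp⟩
  obtain ⟨r, hr, hrG, γ, hγ, hγu⟩ := exists_local_modulus hG hu hc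
  have hγ0 : ∀ w ∈ ball c r, γ w ≠ 0 := fun w hw h0 => by
    have := hγu w hw
    rw [h0, norm_zero] at this
    exact (Real.exp_pos _).ne this
  have hbase : ∀ z ∈ ball c r, ∀ w ∈ ball c r, K₂ z w = γ z * conj (γ w) * K₁ z w := by
    intro z hz w hw
    refine sub_eq_zero.1 (eq_zero_of_diag (L := fun z w => K₂ z w - γ z * conj (γ w) * K₁ z w)
      (c := c) (R := r) ?_ ?_ ?_ z hz w hw)
    · intro w hw
      exact ((h₂ w (hrG hw)).mono hrG).sub
        ((hγ.mul_const _).mul ((h₁ w (hrG hw)).mono hrG))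
    · intro z hz
      simp only [map_sub, map_mul, conj_conj]
      exact ((h₂' z (hrG hz)).mono hrG).sub
        ((hγ.const_mul _).mul ((h₁' z (hrG hz)).mono hrG))
    · intro z hz
      have : γ z * conj (γ z) = (Real.exp (2 * u z) : ℂ) := by
        rw [mul_conj, normSq_eq_norm_sq, hγu z hz, ← Real.exp_nat_mul]
        norm_num
      rw [this, hdiag z (hrG hz), sub_self]
  let S : Set ℂ := {z | ∃ s g, IsLocalFactor G u K₁ K₂ (ball c r) γ z s g}
  have hcS : c ∈ S := ⟨r, γ, hr, hrG, hγ, hγu, hbase⟩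
  have hSo : IsOpen S := by
    refine Metric.isOpen_iff.2 fun z hz => ?_
    obtain ⟨s, g, hg⟩ := hz
    exact ⟨s, hg.1, fun x hx => (hg.restrict hx).imp fun t ht => ⟨g, ht⟩⟩
  have hScl : closure S ∩ G ⊆ S := by
    rintro b ⟨hbS, hbG⟩
    obtain ⟨ρ, hρ, hρG, η, hη, hηu⟩ := exists_local_modulus hG hu hbG
    have hη0 : ∀ w ∈ ball b ρ, η w ≠ 0 := fun w hw h0 => by
      have := hηu w hw
      rw [h0, norm_zero] at this
      exact (Real.exp_pos _).ne this
    obtain ⟨a, haS, hab⟩ := Metric.mem_closure_iff.1 hbS ρ hρ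
    have haρ : a ∈ ball b ρ := by rwa [mem_ball, dist_comm]
    obtain ⟨s, g, hs, hsG, hg, hgu, hgK⟩ := haS
    obtain ⟨t, ht, hts⟩ := Metric.isOpen_iff.1 (isOpen_ball.inter isOpen_ball) a
      (show a ∈ ball a s ∩ ball b ρ from ⟨mem_ball_self hs, haρ⟩)
    obtain ⟨l, hl, hgl⟩ := exists_const_of_norm_eq ht
      (hg.mono fun x hx => (hts hx).1) (hη.mono fun x hx => (hts hx).2)
      (fun x hx => hη0 x (hts hx).2)
      fun x hx => by rw [hgu x (hts hx).1, hηu x (hts hx).2]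
    refine ⟨ρ, fun x => l * η x, hρ, hρG, hη.const_mul l,
      fun x hx => by rw [norm_mul, hl, one_mul, hηu x hx], fun x hx w hw => ?_⟩
    refine eqOn_of_eqOn_ball isOpen_ball (convex_ball b ρ).isPreconnected
      ((h₂ w (hrG hw)).mono hρG)
      (((hη.const_mul l).mul_const (conj (γ w))).mul ((h₁ w (hrG hw)).mono hρG)) ht haρ
      (fun y hy => ?_) hx
    change K₂ y w = l * η y * conj (γ w) * K₁ y w
    rw [hgK y (hts hy).1 w hw, hgl y hy]
  have hGS : G ⊆ S := hGc.subset_of_closure_inter_subset hSo ⟨c, hc, hcS⟩ hScl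
  have hnz : ∀ z ∈ G, ∃ w ∈ ball c r, K₁ z w ≠ 0 := by
    intro z hz
    by_contra! h
    have := eqOn_of_eqOn_ball hG hGc (h₁' z hz) (differentiableOn_const (0 : ℂ)) hr hc
      (fun w hw => by simp [h w hw]) hz
    exact hne z hz (by simpa using this)
  have huniq : ∀ z ∈ G, ∀ p q : ℂ, (∀ w ∈ ball c r, K₂ z w = p * conj (γ w) * K₁ z w) →
      (∀ w ∈ ball c r, K₂ z w = q * conj (γ w) * K₁ z w) → p = q := by
    intro z hz p q hp hq
    obtain ⟨w, hw, hw0⟩ := hnz z hz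
    have h := (hp w hw).symm.trans (hq w hw)
    rw [mul_assoc, mul_assoc] at h
    exact mul_right_cancel₀ (mul_ne_zero ((map_ne_zero _).2 (hγ0 w hw)) hw0) h
  choose! s f hf using fun z (hz : z ∈ G) => hGS hz
  have hloc : ∀ z ∈ G, ∀ x ∈ ball z (s z), f x x = f z x := by
    intro z hz x hx
    have hxG := (hf z hz).2.1 hx
    exact huniq x hxG _ _ ((hf x hxG).2.2.2.2 x (mem_ball_self (hf x hxG).1))
      ((hf z hz).2.2.2.2 x hx)
  have hgd : DifferentiableOn ℂ (fun z => f z z) G := by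
    intro z hz
    have hball : ball z (s z) ∈ 𝓝 z := ball_mem_nhds z (hf z hz).1
    refine DifferentiableAt.differentiableWithinAt ?_
    refine ((hf z hz).2.2.1.differentiableAt hball).congr_of_eventuallyEq ?_
    filter_upwards [hball] with x hx using hloc z hz x hx
  have hgγ : ∀ z ∈ ball c r, f z z = γ z := fun z hz =>
    huniq z (hrG hz) _ _
      ((hf z (hrG hz)).2.2.2.2 z (mem_ball_self (hf z (hrG hz)).1)) (hbase z hz)
  refine ⟨fun z => f z z, hgd, fun z hz => (hf z hz).2.2.2.1 z (mem_ball_self (hf z hz).1),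
    fun z hz w hw => ?_⟩
  have h := eqOn_of_eqOn_ball hG hGc (h₂' z hz)
    ((hgd.const_mul (conj (f z z))).mul (h₁' z hz)) hr hc (fun x hx => ?_) hw
  · have h' := congrArg conj h
    simpa using! h'
  · change conj (K₂ z x) = conj (f z z) * f x x * conj (K₁ z x)
    rw [(hf z hz).2.2.2.2 z (mem_ball_self (hf z hz).1) x hx, hgγ x hx]
    simp

end SesquianalyticKernel

/-- If `K₁, K₂` are hermitian-positive kernels on a simply connected domain `G`,
analytic in the first and anti-analytic in the second variable, with
`K₁(z,z) > 0` and `K₂(z,z) = e^{2u(z)} K₁(z,z)` for a harmonic function `u`, then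
there is a zero-free analytic `g` with `|g| = e^u` and
`K₂(z,w) = g(z) conj(g(w)) K₁(z,w)` on `G × G`. -/
theorem stmt_9 (G : Set ℂ) (hG : IsOpen G) (hGconn : IsPreconnected G)
    (hGsc : SimplyConnectedSpace G)
    (K₁ K₂ : ℂ → ℂ → ℂ)
    (hpos₁ : HermitianPositive K₁ G) (hpos₂ : HermitianPositive K₂ G)
    (hol₁ : ∀ w ∈ G, AnalyticOn ℂ (fun z => K₁ z w) G)
    (antihol₁ : ∀ z ∈ G, AnalyticOn ℂ (fun w => (starRingEnd ℂ) (K₁ z w)) G)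
    (hol₂ : ∀ w ∈ G, AnalyticOn ℂ (fun z => K₂ z w) G)
    (antihol₂ : ∀ z ∈ G, AnalyticOn ℂ (fun w => (starRingEnd ℂ) (K₂ z w)) G)
    (hdiagpos : ∀ z ∈ G, 0 < (K₁ z z).re)
    (u : ℂ → ℝ) (hu : HarmonicOn u G)
    (hdiag : ∀ z ∈ G, K₂ z z = Complex.ofReal (Real.exp (2 * u z)) * K₁ z z) :
    ∃ g : ℂ → ℂ, AnalyticOn ℂ g G ∧ (∀ z ∈ G, g z ≠ 0) ∧
      (∀ z ∈ G, ‖g z‖ = Real.exp (u z)) ∧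
      ∀ z ∈ G, ∀ w ∈ G, K₂ z w = g z * (starRingEnd ℂ) (g w) * K₁ z w := by
  obtain ⟨g, hg, hgu, hK⟩ := SesquianalyticKernel.exists_factor hG hGconn
    (fun w hw => (hol₁ w hw).differentiableOn) (fun z hz => (antihol₁ z hz).differentiableOn)
    (fun w hw => (hol₂ w hw).differentiableOn) (fun z hz => (antihol₂ z hz).differentiableOn)
    (fun z hz h => by simpa [h] using hdiagpos z hz) hu hdiag
  refine ⟨g, (hg.analyticOnNhd hG).analyticOn, fun z hz h0 => ?_, hgu, hK⟩
  have := hgu z hz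
  rw [h0, norm_zero] at this
  exact (Real.exp_pos _).ne this
end

section
/- Let ψ_j be analytic in a domain G, Ψ = (ψ_j), and suppose log K₁(z,z) − log K₂(z,z) is harmonic on G where K_i(z,z) = ‖Ψ_i(z)‖² > 0. If Ψ₁ and Ψ₂ are holomorphic curves in ℂ^N with linearly independent components whose counting measures of expected zeros (Riesz measures of log‖Ψ_i‖) coincide, then N is the same for both and there is a zero-free analytic g on G and a unitary U on ℂ^N with Ψ₂(z) = g(z)·U·Ψ₁(z). -/
open MeasureTheory Real Complex Matrix

open Filter Topology ComplexConjugate InnerProductSpace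

theorem sum_deriv_mul_conj_eq_zero {ι : Type*} [Fintype ι] {G : Set ℂ} (hG : IsOpen G)
    {A B : ι → ℂ → ℂ} (hA : ∀ k, AnalyticOnNhd ℂ (A k) G) (hB : ∀ k, AnalyticOnNhd ℂ (B k) G)
    (h : ∀ z ∈ G, ∑ k, A k z * conj (B k z) = 0) :
    ∀ z ∈ G, ∑ k, deriv (A k) z * conj (B k z) = 0 := by
  intro z hz
  have key : ∀ v : ℂ, ∑ k, (deriv (A k) z * v * conj (B k z) +
      A k z * conj (deriv (B k) z * v)) = 0 := by
    intro v
    have hl : HasDerivAt (fun t : ℝ => z + t * v) v 0 := by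
      simpa using ((Complex.ofRealCLM.hasDerivAt (x := 0)).mul_const v).const_add z
    have hd : ∀ {f : ℂ → ℂ}, AnalyticOnNhd ℂ f G →
        HasDerivAt (fun t : ℝ => f (z + t * v)) (deriv f z * v) 0 := by
      intro f hf
      have h1 : HasDerivAt f (deriv f z) (z + ((0 : ℝ) : ℂ) * v) := by
        simpa using (hf z hz).differentiableAt.hasDerivAt
      simpa [Function.comp_def] using h1.scomp (0 : ℝ) hl |>.congr_deriv (mul_comm _ _)
    have hsum : HasDerivAt (fun t : ℝ => ∑ k, A k (z + t * v) * conj (B k (z + t * v)))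
        (∑ k, (deriv (A k) z * v * conj (B k z) + A k z * conj (deriv (B k) z * v))) 0 := by
      refine HasDerivAt.fun_sum fun k _ => ?_
      have := (hd (hA k)).mul
        (Complex.conjCLE.toContinuousLinearMap.hasFDerivAt.comp_hasDerivAt (0 : ℝ) (hd (hB k)))
      refine (this.congr_deriv ?_)
      simp
    refine hsum.unique ((hasDerivAt_const (0 : ℝ) (0 : ℂ)).congr_of_eventuallyEq ?_)
    have hc : Tendsto (fun t : ℝ => z + t * v) (𝓝 0) (𝓝 z) := by
      simpa using hl.continuousAt.tendsto
    filter_upwards [hc (hG.mem_nhds hz)] with t ht using h _ ht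
  have h1 := key 1
  have h2 := key I
  simp only [Finset.sum_add_distrib, map_mul, conj_I, mul_one] at h1 h2
  have e1 : ∑ k, deriv (A k) z * I * conj (B k z) = I * ∑ k, deriv (A k) z * conj (B k z) := by
    rw [Finset.mul_sum]; exact Finset.sum_congr rfl fun _ _ => by ring
  have e2 : ∑ k, A k z * (conj (deriv (B k) z) * -I) =
      -I * ∑ k, A k z * conj (deriv (B k) z) := by
    rw [Finset.mul_sum]; exact Finset.sum_congr rfl fun _ _ => by ring
  rw [e1, e2] at h2
  linear_combination (1 / 2 : ℂ) * h1 - (I / 2) * h2 +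
    (1 / 2 : ℂ) * (∑ k, deriv (A k) z * conj (B k z) -
      ∑ k, A k z * conj (deriv (B k) z)) * I_sq

/-- Polarization: a sesqui-holomorphic kernel vanishing on the diagonal vanishes identically. -/
theorem sum_mul_conj_eq_zero_of_diagonal {ι : Type*} [Fintype ι] {G : Set ℂ} (hG : IsOpen G)
    (hGc : IsPreconnected G)
    {A B : ι → ℂ → ℂ} (hA : ∀ k, AnalyticOnNhd ℂ (A k) G) (hB : ∀ k, AnalyticOnNhd ℂ (B k) G)
    (h : ∀ z ∈ G, ∑ k, A k z * conj (B k z) = 0) :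
    ∀ z ∈ G, ∀ w ∈ G, ∑ k, A k z * conj (B k w) = 0 := by
  have hn : ∀ n : ℕ, (∀ k, AnalyticOnNhd ℂ (deriv^[n] (A k)) G) ∧
      ∀ z ∈ G, ∑ k, deriv^[n] (A k) z * conj (B k z) = 0 := by
    intro n
    induction n with
    | zero => exact ⟨hA, h⟩
    | succ n ih =>
      simp only [Function.iterate_succ_apply']
      exact ⟨fun k => (ih.1 k).deriv, sum_deriv_mul_conj_eq_zero hG ih.1 hB ih.2⟩
  intro z hz w hw
  have han : AnalyticOnNhd ℂ (fun z => ∑ k, A k z * conj (B k w)) G := fun x hx =>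
    Finset.analyticAt_fun_sum _ fun k _ => (hA k x hx).mul analyticAt_const
  refine han.eqOn_zero_of_preconnected_of_eventuallyEq_zero hGc hw ?_ hz
  have hps := (han w hw).hasFPowerSeriesAt
  have hit : ∀ n, iteratedDeriv n (fun z => ∑ k, A k z * conj (B k w)) w = 0 := by
    intro n
    rw [iteratedDeriv_fun_sum fun k _ => ((hA k w hw).fun_mul analyticAt_const).contDiffAt]
    rw [← (hn n).2 w hw]
    refine Finset.sum_congr rfl fun k _ => ?_
    rw [iteratedDeriv_mul_const_field, iteratedDeriv_eq_iterate]
  apply HasFPowerSeriesAt.eventually_eq_zero (𝕜 := ℂ)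
  convert! hps using 1
  ext n
  simp [hit]

theorem AnalyticAt.log_sum_norm_sq {ι : Type*} [Fintype ι] {ψ : ι → ℂ → ℂ} {z : ℂ}
    (hψ : ∀ j, AnalyticAt ℂ (ψ j) z) (hpos : 0 < ∑ j, ‖ψ j z‖ ^ 2) :
    AnalyticAt ℝ (fun w => Real.log (∑ j, ‖ψ j w‖ ^ 2)) z := by
  have hterm : ∀ j, AnalyticAt ℝ (fun w => ‖ψ j w‖ ^ 2) z := by
    intro j
    have h : AnalyticAt ℝ (ψ j) z := (hψ j).restrictScalars
    have hre : AnalyticAt ℝ (fun w => (ψ j w).re) z := (Complex.reCLM.analyticAt (ψ j z)).comp h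
    have him : AnalyticAt ℝ (fun w => (ψ j w).im) z := (Complex.imCLM.analyticAt (ψ j z)).comp h
    refine ((hre.pow 2).add (him.pow 2)).congr (.of_forall fun w => ?_)
    change (ψ j w).re ^ 2 + (ψ j w).im ^ 2 = ‖ψ j w‖ ^ 2
    rw [← Complex.normSq_eq_norm_sq, Complex.normSq_apply, sq, sq]
  have hsum : AnalyticAt ℝ (fun w => ∑ j, ‖ψ j w‖ ^ 2) z :=
    Finset.univ.analyticAt_fun_sum fun j _ => hterm j
  exact AnalyticAt.comp (g := Real.log) (analyticAt_log hpos) hsum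

theorem exists_linearIsometryEquiv_of_inner_eq {X : Type*} {N₁ N₂ : ℕ}
    (Ψ : X → EuclideanSpace ℂ (Fin N₁)) (Φ : X → EuclideanSpace ℂ (Fin N₂))
    (hgram : ∀ x y, inner ℂ (Ψ x) (Ψ y) = inner ℂ (Φ x) (Φ y))
    (hΨ : Submodule.span ℂ (Set.range Ψ) = ⊤) (hΦ : Submodule.span ℂ (Set.range Φ) = ⊤) :
    ∃ L : EuclideanSpace ℂ (Fin N₁) ≃ₗᵢ[ℂ] EuclideanSpace ℂ (Fin N₂), ∀ x, L (Ψ x) = Φ x := by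
  set T₁ := Finsupp.linearCombination ℂ Ψ with hT₁
  set T₂ := Finsupp.linearCombination ℂ Φ with hT₂
  have hin : ∀ c, inner ℂ (T₁ c) (T₁ c) = inner ℂ (T₂ c) (T₂ c) := by
    intro c
    simp only [hT₁, hT₂, Finsupp.linearCombination_apply, Finsupp.sum, sum_inner, inner_sum,
      inner_smul_left, inner_smul_right, hgram]
  have hnorm : ∀ c, ‖T₁ c‖ = ‖T₂ c‖ := by
    intro c
    rw [@norm_eq_sqrt_re_inner ℂ, hin, ← @norm_eq_sqrt_re_inner ℂ]
  have hs₁ : LinearMap.range T₁ = ⊤ := by rw [hT₁, Finsupp.range_linearCombination, hΨ]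
  have hs₂ : Function.Surjective T₂ := by
    rw [← LinearMap.range_eq_top, hT₂, Finsupp.range_linearCombination, hΦ]
  obtain ⟨S, hS⟩ := T₁.exists_rightInverse_of_surjective hs₁
  have hTS : ∀ x, T₁ (S x) = x := fun x => by simpa using LinearMap.congr_fun hS x
  have hL : ∀ c, T₂ (S (T₁ c)) = T₂ c := by
    intro c
    rw [← sub_eq_zero, ← map_sub, ← norm_eq_zero, ← hnorm, map_sub, hTS, sub_self, norm_zero]
  let L : EuclideanSpace ℂ (Fin N₁) →ₗᵢ[ℂ] EuclideanSpace ℂ (Fin N₂) :=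
    ⟨T₂ ∘ₗ S, fun x => by simp [← hnorm, hTS]⟩
  have hLs : Function.Surjective L := fun y => by
    obtain ⟨c, rfl⟩ := hs₂ y
    exact ⟨T₁ c, hL c⟩
  refine ⟨LinearIsometryEquiv.ofSurjective L hLs, fun x => ?_⟩
  have := hL (Finsupp.single x 1)
  simpa [hT₁, hT₂, L] using this

theorem span_range_eq_top {X : Type*} {N : ℕ} (Ψ : X → EuclideanSpace ℂ (Fin N))
    (h : ∀ c : Fin N → ℂ, (∀ x, ∑ j, c j * Ψ x j = 0) → c = 0) :
    Submodule.span ℂ (Set.range Ψ) = ⊤ := by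
  rw [← Submodule.orthogonal_eq_bot_iff, Submodule.eq_bot_iff]
  intro v hv
  have : (fun j => conj (v j)) = 0 := h _ fun x => by
    have := (Submodule.mem_orthogonal' _ _).1 hv (Ψ x) (Submodule.subset_span ⟨x, rfl⟩)
    rw [PiLp.inner_apply] at this
    simpa [mul_comm] using this
  ext j
  simpa using congr_fun this j

theorem integral_partialSum_three (p : FormalMultilinearSeries ℝ ℂ ℝ) (r : ℝ) :
    ∫ θ in (0 : ℝ)..(2 * π), p.partialSum 3 (r * exp (θ * I)) =
      2 * π * p 0 0 + π * r ^ 2 * (p 2 ![1, 1] + p 2 ![I, I]) := by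
  have hexp : ∀ θ : ℝ, p.partialSum 3 (r * exp (θ * I)) =
      p 0 0 + (r * p 1 ![1]) * Real.cos θ + (r * p 1 ![I]) * Real.sin θ
      + (r ^ 2 * p 2 ![1, 1]) * Real.cos θ ^ 2
      + (r ^ 2 * (p 2 ![1, I] + p 2 ![I, 1])) * (Real.sin θ * Real.cos θ)
      + (r ^ 2 * p 2 ![I, I]) * Real.sin θ ^ 2 := by
    intro θ
    have hy : (r * exp (θ * I) : ℂ) = (r * Real.cos θ) • (1 : ℂ) + (r * Real.sin θ) • I := by
      rw [exp_mul_I]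
      push_cast [Complex.real_smul]
      ring
    have hone : ∀ v : ℂ, p 1 (fun _ => v) = p 1 ![v] := fun v => by
      congr 1; ext i; simp
    have h1 : p 1 (fun _ => r * exp (θ * I)) =
        (r * Real.cos θ) * p 1 ![1] + (r * Real.sin θ) * p 1 ![I] := by
      let f : ℂ →ₗ[ℝ] ℝ := (p 1).toMultilinearMap.toLinearMap ![0] 0
      have hf : ∀ v, p 1 (fun _ => v) = f v := fun v => by
        simp only [f, MultilinearMap.toLinearMap_apply]
        change _ = p 1 _
        congr 1; ext i; fin_cases i; simp
      rw [hy, ← hone, ← hone, hf, hf, hf, map_add, map_smul, map_smul, smul_eq_mul, smul_eq_mul]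
    have h2 : p 2 (fun _ => r * exp (θ * I)) =
        (r * Real.cos θ) ^ 2 * p 2 ![1, 1]
          + (r * Real.cos θ) * (r * Real.sin θ) * (p 2 ![1, I] + p 2 ![I, 1])
          + (r * Real.sin θ) ^ 2 * p 2 ![I, I] := by
      have hadd : ∀ (a b c : ℂ), p 2 ![a + b, c] = p 2 ![a, c] + p 2 ![b, c] := fun a b c =>
        (p 2).cons_add ![c] a b
      have hsm : ∀ (s : ℝ) (b c : ℂ), p 2 ![s • b, c] = s * p 2 ![b, c] := fun s b c =>
        (p 2).cons_smul ![c] s b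
      have hupd : ∀ a c : ℂ, Function.update ![c, 0] 1 a = ![c, a] := fun a c => by
        ext i; fin_cases i <;> simp
      have hadd' : ∀ (a b c : ℂ), p 2 ![c, a + b] = p 2 ![c, a] + p 2 ![c, b] := fun a b c => by
        have := (p 2).map_update_add ![c, 0] 1 a b
        rwa [hupd, hupd, hupd] at this
      have hsm' : ∀ (s : ℝ) (b c : ℂ), p 2 ![c, s • b] = s * p 2 ![c, b] := fun s b c => by
        have := (p 2).map_update_smul ![c, 0] 1 s b
        rwa [hupd, hupd, smul_eq_mul] at this
      have : (fun _ : Fin 2 => (r * exp (θ * I) : ℂ)) = ![r * exp (θ * I), r * exp (θ * I)] := by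
        ext i; fin_cases i <;> rfl
      rw [this, hy]
      simp only [hadd, hadd', hsm, hsm']
      ring
    have h0 : p 0 (fun _ => r * exp (θ * I)) = p 0 0 := by
      congr 1; ext i; exact i.elim0
    rw [FormalMultilinearSeries.partialSum, Finset.sum_range_succ, Finset.sum_range_succ,
      Finset.sum_range_one, h0, h1, h2]
    ring
  simp_rw [hexp]
  have hi : ∀ f : ℝ → ℝ, Continuous f → IntervalIntegrable f volume 0 (2 * π) :=
    fun f hf => hf.intervalIntegrable _ _
  rw [intervalIntegral.integral_add, intervalIntegral.integral_add, intervalIntegral.integral_add,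
    intervalIntegral.integral_add, intervalIntegral.integral_add]
  · simp only [intervalIntegral.integral_const_mul, intervalIntegral.integral_const, integral_cos,
      integral_sin, integral_cos_sq, integral_sin_sq, integral_sin_mul_cos₁]
    simp only [sub_zero, smul_eq_mul, Real.sin_two_pi, Real.cos_two_pi, Real.sin_zero,
      Real.cos_zero]
    ring
  all_goals exact hi _ (by fun_prop)

/-- The mean value property forces the second-order Taylor coefficients to be trace-free. -/
theorem HarmonicOn.laplacian_eq_zero {u : ℂ → ℝ} {G : Set ℂ} (hG : IsOpen G)
    (hu : HarmonicOn u G) {z : ℂ} (hz : z ∈ G) (ha : AnalyticAt ℝ u z) :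
    Laplacian.laplacian u z = 0 := by
  obtain ⟨p, ρ, hρ⟩ := ha
  have hlap : Laplacian.laplacian u z = 2 * (p 2 ![1, 1] + p 2 ![I, I]) := by
    have h : ∀ v : ℂ, iteratedFDeriv ℝ 2 u z ![v, v] = 2 * p 2 ![v, v] := by
      intro v
      have : (![v, v] : Fin 2 → ℂ) = fun _ => v := by ext i; fin_cases i <;> rfl
      rw [this, ← hρ.factorial_smul v 2]
      simp
    rw [laplacian_eq_iteratedFDeriv_complexPlane]
    simp only [h]
    ring
  set s := p 2 ![1, 1] + p 2 ![I, I] with hs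
  have hp : HasFPowerSeriesAt u p z := ⟨ρ, hρ⟩
  have hp0 : p 0 0 = u z := hp.coeff_zero 0
  obtain ⟨C, hC⟩ := (hp.isBigO_sub_partialSum_pow 3).bound
  obtain ⟨δ, hδ, hball⟩ := Metric.eventually_nhds_iff.1 hC
  obtain ⟨ε, hε, hεG⟩ := Metric.isOpen_iff.1 hG z hz
  have hbound : ∀ r : ℝ, 0 < r → r < min δ ε → |s| ≤ 2 * C * r := by
    intro r hr hrm
    have hsub : Metric.closedBall z r ⊆ G :=
      (Metric.closedBall_subset_ball (hrm.trans_le (min_le_right _ _))).trans hεG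
    have hnorm : ∀ θ : ℝ, ‖(r * exp (θ * I) : ℂ)‖ = r := fun θ => by
      simp [Complex.norm_exp_ofReal_mul_I, abs_of_pos hr]
    have hmv := hu.2 z hz r hr hsub
    have hcont : Continuous fun θ : ℝ => u (z + r * exp (θ * I)) :=
      hu.1.comp_continuous (by fun_prop) fun θ => hsub (by simp [abs_of_pos hr])
    have hcontp : Continuous fun θ : ℝ => p.partialSum 3 (r * exp (θ * I)) :=
      (p.partialSum_continuous 3).comp (by fun_prop)
    have hle : ‖∫ θ in (0 : ℝ)..(2 * π),
        (u (z + r * exp (θ * I)) - p.partialSum 3 (r * exp (θ * I)))‖ ≤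
        C * r ^ 3 * |2 * π - 0| := by
      refine intervalIntegral.norm_integral_le_of_norm_le_const fun θ _ => ?_
      have := hball (y := r * exp (θ * I)) (by
        rw [dist_zero_right, hnorm]; exact hrm.trans_le (min_le_left _ _))
      simpa [hnorm, abs_of_pos hr] using this
    rw [intervalIntegral.integral_sub (hcont.intervalIntegrable _ _)
      (hcontp.intervalIntegrable _ _), integral_partialSum_three, hp0, ← hs] at hle
    have hI : ∫ θ in (0 : ℝ)..(2 * π), u (z + r * exp (θ * I)) = 2 * π * u z := by
      rw [hmv, ← mul_assoc, mul_one_div_cancel Real.two_pi_pos.ne', one_mul]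
    rw [hI, sub_zero, abs_of_pos Real.two_pi_pos, Real.norm_eq_abs] at hle
    have : 2 * π * u z - (2 * π * u z + π * r ^ 2 * s) = -(π * r ^ 2 * s) := by ring
    rw [this, abs_neg, abs_mul, abs_of_pos (by positivity : 0 < π * r ^ 2)] at hle
    refine le_of_mul_le_mul_left (hle.trans_eq ?_) (by positivity : 0 < π * r ^ 2)
    ring
  have hlim : Tendsto (fun r : ℝ => 2 * C * r) (𝓝[>] 0) (𝓝 0) := by
    have : Tendsto (fun r : ℝ => 2 * C * r) (𝓝 0) (𝓝 (2 * C * 0)) :=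
      (continuous_const.mul continuous_id).tendsto 0
    rw [mul_zero] at this
    exact this.mono_left nhdsWithin_le_nhds
  have hs0 : |s| ≤ 0 := by
    refine ge_of_tendsto hlim ?_
    filter_upwards [Ioo_mem_nhdsGT (lt_min hδ hε)] with r hr using hbound r hr.1 hr.2
  rw [hlap, abs_nonpos_iff.1 hs0, mul_zero]

theorem HarmonicOn.exists_ball_re_eq {u : ℂ → ℝ} {G : Set ℂ} (hG : IsOpen G)
    (hu : HarmonicOn u G) (ha : AnalyticOnNhd ℝ u G) {z : ℂ} (hz : z ∈ G) :
    ∃ ε > 0, Metric.ball z ε ⊆ G ∧ ∃ F : ℂ → ℂ, AnalyticOnNhd ℂ F (Metric.ball z ε) ∧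
      ∀ w ∈ Metric.ball z ε, (F w).re = u w := by
  obtain ⟨ε, hε, hεG⟩ := Metric.isOpen_iff.1 hG z hz
  have hharm : InnerProductSpace.HarmonicOnNhd u (Metric.ball z ε) := fun w hw => by
    refine ⟨(ha w (hεG hw)).contDiffAt, ?_⟩
    filter_upwards [hG.mem_nhds (hεG hw)] with x hx
    exact hu.laplacian_eq_zero hG hx (ha x hx)
  obtain ⟨F, hF, hFu⟩ := hharm.exists_analyticOnNhd_ball_re_eq
  exact ⟨ε, hε, hεG, F, hF, hFu⟩

/-- Two nondegenerate holomorphic curves with equal norms differ by a unitary. -/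
theorem exists_unitary_of_sum_norm_sq_eq {D : Set ℂ} (hD : IsOpen D) (hDc : IsPreconnected D)
    {N₁ N₂ : ℕ} {ψ : Fin N₁ → ℂ → ℂ} {φ : Fin N₂ → ℂ → ℂ}
    (hψ : ∀ j, AnalyticOnNhd ℂ (ψ j) D) (hφ : ∀ j, AnalyticOnNhd ℂ (φ j) D)
    (hli₁ : ∀ c : Fin N₁ → ℂ, (∀ z ∈ D, ∑ j, c j * ψ j z = 0) → c = 0)
    (hli₂ : ∀ c : Fin N₂ → ℂ, (∀ z ∈ D, ∑ j, c j * φ j z = 0) → c = 0)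
    (h : ∀ z ∈ D, ∑ j, ‖ψ j z‖ ^ 2 = ∑ j, ‖φ j z‖ ^ 2) :
    N₁ = N₂ ∧ ∃ U : Matrix (Fin N₂) (Fin N₁) ℂ,
      U.conjTranspose * U = 1 ∧ U * U.conjTranspose = 1 ∧
      ∀ z ∈ D, ∀ i, φ i z = ∑ j, U i j * ψ j z := by
  have hpol : ∀ z ∈ D, ∀ w ∈ D,
      ∑ j, ψ j z * conj (ψ j w) = ∑ j, φ j z * conj (φ j w) := by
    intro z hz w hw
    have := sum_mul_conj_eq_zero_of_diagonal hD hDc (ι := Fin N₁ ⊕ Fin N₂)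
      (A := Sum.elim ψ (fun j x => -φ j x)) (B := Sum.elim ψ φ)
      (by rintro (j | j); exacts [hψ j, (hφ j).neg])
      (by rintro (j | j); exacts [hψ j, hφ j])
      (fun x hx => by
        have hx' := congrArg (fun t : ℝ => (t : ℂ)) (h x hx)
        push_cast at hx'
        simp [Complex.mul_conj', hx']) z hz w hw
    simpa [← sub_eq_add_neg, sub_eq_zero] using this
  let Ψ : D → EuclideanSpace ℂ (Fin N₁) := fun z => WithLp.toLp 2 fun j => ψ j z
  let Φ : D → EuclideanSpace ℂ (Fin N₂) := fun z => WithLp.toLp 2 fun j => φ j z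
  obtain ⟨L, hL⟩ := exists_linearIsometryEquiv_of_inner_eq Ψ Φ
    (fun z w => by simpa [PiLp.inner_apply, Ψ, Φ] using hpol w w.2 z z.2)
    (span_range_eq_top Ψ fun c hc => hli₁ c fun z hz => hc ⟨z, hz⟩)
    (span_range_eq_top Φ fun c hc => hli₂ c fun z hz => hc ⟨z, hz⟩)
  have hN : N₁ = N₂ := by simpa using L.toLinearEquiv.finrank_eq
  subst hN
  let U : Matrix (Fin N₁) (Fin N₁) ℂ := .of fun i j => L (EuclideanSpace.single j 1) i
  have hU : U.conjTranspose * U = 1 := by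
    ext j k
    have := L.inner_map_map (EuclideanSpace.single j 1) (EuclideanSpace.single k 1)
    rw [PiLp.inner_apply, EuclideanSpace.inner_single_left] at this
    simpa [Matrix.mul_apply, U, Matrix.one_apply, mul_comm, Pi.single_apply] using this
  refine ⟨rfl, U, hU, mul_eq_one_comm.1 hU, fun z hz i => ?_⟩
  have hsum : Ψ ⟨z, hz⟩ = ∑ j, ψ j z • EuclideanSpace.single j (1 : ℂ) := by
    ext k
    simp [Ψ, Pi.single_apply]
  have := congrArg (fun v => v i) (hL ⟨z, hz⟩)
  rw [hsum, map_sum] at this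
  simpa [U, Φ, mul_comm, eq_comm] using this

/-- Pointwise proportional nowhere vanishing holomorphic curves differ by a holomorphic factor. -/
theorem exists_analytic_factor {G : Set ℂ} (hG : IsOpen G) {ι : Type*} {χ φ : ι → ℂ → ℂ}
    (hχ : ∀ i, AnalyticOnNhd ℂ (χ i) G) (hφ : ∀ i, AnalyticOnNhd ℂ (φ i) G)
    (hχ0 : ∀ z ∈ G, ∃ i, χ i z ≠ 0) (hφ0 : ∀ z ∈ G, ∃ i, φ i z ≠ 0)
    (h : ∀ z ∈ G, ∀ i k, χ i z * φ k z = χ k z * φ i z) :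
    ∃ g : ℂ → ℂ, AnalyticOnNhd ℂ g G ∧ (∀ z ∈ G, g z ≠ 0) ∧
      ∀ z ∈ G, ∀ i, φ i z = g z * χ i z := by
  have hex : ∀ z, ∃ c : ℂ, z ∈ G → ∀ i, φ i z = c * χ i z := by
    intro z
    by_cases hz : z ∈ G
    · obtain ⟨k, hk⟩ := hχ0 z hz
      refine ⟨φ k z / χ k z, fun _ i => ?_⟩
      rw [div_mul_eq_mul_div, eq_div_iff hk, mul_comm, h z hz k i, mul_comm]
    · exact ⟨0, fun h => absurd h hz⟩
  choose g hg using hex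
  refine ⟨g, fun z hz => ?_, fun z hz h0 => ?_, hg⟩
  · obtain ⟨k, hk⟩ := hχ0 z hz
    refine ((hφ k z hz).fun_div (hχ k z hz) hk).congr ?_
    filter_upwards [hG.mem_nhds hz, (hχ k z hz).continuousAt.eventually_ne hk] with w hw hwk
    rw [div_eq_iff hwk, hg w hw k]
  · obtain ⟨i, hi⟩ := hφ0 z hz
    exact hi (by rw [hg z hz i, h0, zero_mul])

theorem exists_ne_zero_of_sum_norm_sq_pos {ι : Type*} [Fintype ι] {v : ι → ℂ}
    (h : 0 < ∑ j, ‖v j‖ ^ 2) : ∃ j, v j ≠ 0 := by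
  by_contra! h0
  simp [h0] at h

/-- Calabi rigidity for holomorphic curves: if `Ψ₁ : G → ℂ^{N₁}` and `Ψ₂ : G → ℂ^{N₂}`
are holomorphic curves with linearly independent components, with `‖Ψ_i(z)‖² > 0` on `G`,
and their expected zero measures coincide — i.e. `log ‖Ψ₁‖² − log ‖Ψ₂‖²` is harmonic on
`G` — then `N₁ = N₂` and `Ψ₂ = g · U · Ψ₁` for a zero-free analytic function `g` and a
unitary matrix `U`. -/
theorem stmt_10 (G : Set ℂ) (hG : IsOpen G) (hGconn : IsPreconnected G)
    (N₁ N₂ : ℕ) (ψ₁ : Fin N₁ → ℂ → ℂ) (ψ₂ : Fin N₂ → ℂ → ℂ)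
    (hψ₁ : ∀ j, AnalyticOn ℂ (ψ₁ j) G) (hψ₂ : ∀ j, AnalyticOn ℂ (ψ₂ j) G)
    (hli₁ : ∀ c : Fin N₁ → ℂ, (∀ z ∈ G, ∑ j, c j * ψ₁ j z = 0) → c = 0)
    (hli₂ : ∀ c : Fin N₂ → ℂ, (∀ z ∈ G, ∑ j, c j * ψ₂ j z = 0) → c = 0)
    (hpos₁ : ∀ z ∈ G, 0 < ∑ j, ‖ψ₁ j z‖ ^ 2)
    (hpos₂ : ∀ z ∈ G, 0 < ∑ j, ‖ψ₂ j z‖ ^ 2)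
    (hharm : HarmonicOn
      (fun z => Real.log (∑ j, ‖ψ₁ j z‖ ^ 2) - Real.log (∑ j, ‖ψ₂ j z‖ ^ 2)) G) :
    N₁ = N₂ ∧
      ∃ g : ℂ → ℂ, AnalyticOn ℂ g G ∧ (∀ z ∈ G, g z ≠ 0) ∧
        ∃ U : Matrix (Fin N₂) (Fin N₁) ℂ,
          U.conjTranspose * U = 1 ∧ U * U.conjTranspose = 1 ∧
          ∀ z ∈ G, ∀ i, ψ₂ i z = g z * ∑ j, U i j * ψ₁ j z := by
  replace hψ₁ := fun j => hG.analyticOn_iff_analyticOnNhd.1 (hψ₁ j)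
  replace hψ₂ := fun j => hG.analyticOn_iff_analyticOnNhd.1 (hψ₂ j)
  rcases G.eq_empty_or_nonempty with rfl | ⟨z₀, hz₀⟩
  · obtain rfl : N₁ = 0 := by
      by_contra hN
      have := congr_fun (hli₁ 1 (by simp)) ⟨0, Nat.pos_of_ne_zero hN⟩
      simp at this
    obtain rfl : N₂ = 0 := by
      by_contra hN
      have := congr_fun (hli₂ 1 (by simp)) ⟨0, Nat.pos_of_ne_zero hN⟩
      simp at this
    exact ⟨rfl, 1, analyticOn_empty, by simp, 1, by simp, by simp, by simp⟩
  obtain ⟨ε, hε, hεG, F, hF, hFu⟩ := hharm.exists_ball_re_eq hG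
    (fun z hz => (AnalyticAt.log_sum_norm_sq (fun j => hψ₁ j z hz) (hpos₁ z hz)).fun_sub
      (AnalyticAt.log_sum_norm_sq (fun j => hψ₂ j z hz) (hpos₂ z hz))) hz₀
  set D := Metric.ball z₀ ε
  have hDz₀ : D ∈ 𝓝 z₀ := Metric.ball_mem_nhds z₀ hε
  have hident : ∀ f : ℂ → ℂ, AnalyticOnNhd ℂ f G → (∀ z ∈ D, f z = 0) → ∀ z ∈ G, f z = 0 :=
    fun f hf h0 => hf.eqOn_zero_of_preconnected_of_eventuallyEq_zero hGconn hz₀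
      (Filter.eventually_of_mem hDz₀ h0)
  have hlin : ∀ {N : ℕ} {ψ : Fin N → ℂ → ℂ}, (∀ j, AnalyticOnNhd ℂ (ψ j) G) →
      ∀ c : Fin N → ℂ, AnalyticOnNhd ℂ (fun z => ∑ j, c j * ψ j z) G := fun hψ c z hz =>
    Finset.analyticAt_fun_sum _ fun j _ => analyticAt_const.fun_mul (hψ j z hz)
  have hγ : ∀ z ∈ D, ‖exp (F z / 2)‖ ^ 2 * ∑ j, ‖ψ₂ j z‖ ^ 2 = ∑ j, ‖ψ₁ j z‖ ^ 2 := by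
    intro z hz
    have h2 : (F z / 2).re + (F z / 2).re = (F z).re := by simp
    rw [Complex.norm_exp, sq, ← Real.exp_add, h2, hFu z hz, Real.exp_sub,
      Real.exp_log (hpos₁ z (hεG hz)), Real.exp_log (hpos₂ z (hεG hz)),
      div_mul_cancel₀ _ (hpos₂ z (hεG hz)).ne']
  obtain ⟨rfl, U, hU, hU', hUψ⟩ := exists_unitary_of_sum_norm_sq_eq (D := D) Metric.isOpen_ball
    (convex_ball z₀ ε).isPreconnected (ψ := ψ₁) (φ := fun j z => exp (F z / 2) * ψ₂ j z)
    (fun j => (hψ₁ j).mono hεG)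
    (fun j z hz => ((hF z hz).fun_div analyticAt_const two_ne_zero).cexp.fun_mul
      (hψ₂ j z (hεG hz)))
    (fun c hc => hli₁ c (hident _ (hlin hψ₁ c) hc))
    (fun c hc => hli₂ c (hident _ (hlin hψ₂ c) fun z hz => by
      have := hc z hz
      simp_rw [mul_left_comm _ (cexp _), ← Finset.mul_sum] at this
      exact (mul_eq_zero.1 this).resolve_left (exp_ne_zero _)))
    (fun z hz => by simp_rw [norm_mul, mul_pow, ← Finset.mul_sum, hγ z hz])
  have hχ := fun i => hlin hψ₁ (U i)
  obtain ⟨g, hg, hg0, hgψ⟩ := exists_analytic_factor hG (χ := fun i z => ∑ j, U i j * ψ₁ j z) hχ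
    hψ₂
    (fun z hz => by
      by_contra! h0
      have hmul : U *ᵥ (fun j => ψ₁ j z) = 0 := funext h0
      have hzero : (fun j => ψ₁ j z) = 0 := by
        rw [← Matrix.one_mulVec (fun j => ψ₁ j z), ← hU, ← Matrix.mulVec_mulVec, hmul,
          Matrix.mulVec_zero]
      obtain ⟨j, hj⟩ := exists_ne_zero_of_sum_norm_sq_pos (hpos₁ z hz)
      exact hj (congr_fun hzero j))
    (fun z hz => exists_ne_zero_of_sum_norm_sq_pos (hpos₂ z hz))
    (fun z hz i k => sub_eq_zero.1 <| hident _
      (((hχ i).mul (hψ₂ k)).sub ((hχ k).mul (hψ₂ i))) (fun w hw => by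
        simp only [Pi.sub_apply, ← hUψ w hw]
        ring) z hz)
  exact ⟨rfl, g, hg.analyticOn, hg0, U, hU, hU', hgψ⟩
end
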